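/- Let n ≥ 3 and let F = (α+β)²/α be a square metric of scalar flag curvature on a connected open set U (equivalently, suppose (E1)–(E3) hold), and suppose moreover that U ⊆ {x : 1+μ|x|² > 0} and (1−b²)²a_{ij} = ((1+μ|x|²)δ_{ij} − μx_ix_j)/(1+μ|x|²)² on U (i.e., the deformed metric h = (1−b²)α is the standard metric h_μ of constant curvature μ). Then there exist a constant k ∈ ℝ and a constant vector a ∈ ℝⁿ such that α = σ²/(1+μ|x|²)·h_μ and β = σ/(1+μ|x|²)·[⟨a,y⟩ + (k − μ⟨a,x⟩)/(1+μ|x|²)·⟨x,y⟩], where σ(x) := √([k² + (1+|a|²)μ]|x|² + (2k − μ⟨a,x⟩)⟨a,x⟩ + |a|² + 1); moreover the scalar flag curvature of F is K = (k² + μ + μ|a|²)·(1+μ|x|²)³/σ⁶ · α³/(α+β)³. -/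

import Mathlib

open scoped BigOperators

noncomputable section

abbrev Vec (n : ℕ) := Fin n → ℝ

/-- Partial derivative of a function on `ℝⁿ` in the `k`-th coordinate direction. -/
def pd {n : ℕ} (f : Vec n → ℝ) (k : Fin n) (x : Vec n) : ℝ :=
  fderiv ℝ f x (Pi.single k 1)

/-- Partial derivative in the base (`x`) variable of a function of `(x, y)`. -/
def pdx {n : ℕ} (f : Vec n → Vec n → ℝ) (k : Fin n) (x y : Vec n) : ℝ :=
  fderiv ℝ (fun x' => f x' y) x (Pi.single k 1)

/-- Partial derivative in the fiber (`y`) variable of a function of `(x, y)`. -/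
def pdy {n : ℕ} (f : Vec n → Vec n → ℝ) (k : Fin n) (x y : Vec n) : ℝ :=
  fderiv ℝ (fun y' => f x y') y (Pi.single k 1)

/-- The fundamental tensor `g_{ij} = ½ ∂²(F²)/∂yⁱ∂yʲ` of a Finsler metric `F`. -/
def fundTensor {n : ℕ} (F : Vec n → Vec n → ℝ) (x y : Vec n) : Matrix (Fin n) (Fin n) ℝ :=
  Matrix.of fun i j => (1/2) * pdy (fun x y => pdy (fun x y => (F x y)^2) j x y) i x y

/-- The geodesic coefficients `Gⁱ = ¼ g^{il}(yᵏ ∂²(F²)/∂xᵏ∂yˡ − ∂(F²)/∂xˡ)`. -/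
def geoCoeff {n : ℕ} (F : Vec n → Vec n → ℝ) (i : Fin n) (x y : Vec n) : ℝ :=
  (1/4) * ∑ l, (fundTensor F x y)⁻¹ i l *
    ((∑ k, y k * pdx (fun x y => pdy (fun x y => (F x y)^2) l x y) k x y)
      - pdx (fun x y => (F x y)^2) l x y)

/-- Riemann curvature `Rⁱ_k` associated to a spray `G`. -/
def curvOfSpray {n : ℕ} (G : Fin n → Vec n → Vec n → ℝ) (i k : Fin n) (x y : Vec n) : ℝ :=
  2 * pdx (G i) k x y
  - ∑ j, y j * pdx (fun x y => pdy (G i) k x y) j x y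
  + 2 * ∑ j, G j x y * pdy (fun x y => pdy (G i) k x y) j x y
  - ∑ j, pdy (G i) j x y * pdy (G j) k x y

/-- Christoffel symbols `Γᵏ_{ij}` of a Riemannian metric field. -/
def christoffel {n : ℕ} (g : Vec n → Matrix (Fin n) (Fin n) ℝ) (k i j : Fin n) (x : Vec n) : ℝ :=
  (1/2) * ∑ l, (g x)⁻¹ k l *
    (pd (fun x => g x l i) j x + pd (fun x => g x l j) i x - pd (fun x => g x i j) l x)

/-- The geodesic spray `Gⁱ_α = ½ Γⁱ_{jk} yʲ yᵏ` of a Riemannian metric. -/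
def sprayOf {n : ℕ} (g : Vec n → Matrix (Fin n) (Fin n) ℝ) (i : Fin n) (x y : Vec n) : ℝ :=
  (1/2) * ∑ j, ∑ k, christoffel g i j k x * y j * y k

/-- Covariant derivative `b_{i|j}` of a 1-form w.r.t. a Riemannian metric. -/
def covDeriv {n : ℕ} (g : Vec n → Matrix (Fin n) (Fin n) ℝ) (b : Vec n → Vec n)
    (i j : Fin n) (x : Vec n) : ℝ :=
  pd (fun x => b x i) j x - ∑ k, b x k * christoffel g k i j x

/-- `b² = a^{ij} b_i b_j`. -/
def bsq {n : ℕ} (a : Vec n → Matrix (Fin n) (Fin n) ℝ) (b : Vec n → Vec n) (x : Vec n) : ℝ :=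
  ∑ i, ∑ j, (a x)⁻¹ i j * b x i * b x j

/-- `α(x,y) = √(a_{ij}(x) yⁱ yʲ)`. -/
def alphaOf {n : ℕ} (a : Vec n → Matrix (Fin n) (Fin n) ℝ) (x y : Vec n) : ℝ :=
  Real.sqrt (∑ i, ∑ j, a x i j * y i * y j)

/-- `β(x,y) = b_i(x) yⁱ`. -/
def betaOf {n : ℕ} (b : Vec n → Vec n) (x y : Vec n) : ℝ := ∑ i, b x i * y i

/-- The square metric `F = (α+β)²/α`. -/
def sqMetric {n : ℕ} (a : Vec n → Matrix (Fin n) (Fin n) ℝ) (b : Vec n → Vec n)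
    (x y : Vec n) : ℝ :=
  (alphaOf a x y + betaOf b x y)^2 / alphaOf a x y

/-- `F` is of scalar flag curvature on `U`. -/
def IsScalarFlag {n : ℕ} (U : Set (Vec n)) (F : Vec n → Vec n → ℝ) : Prop :=
  ∃ K : Vec n → Vec n → ℝ, ∀ x ∈ U, ∀ y : Vec n, y ≠ 0 → ∀ i k : Fin n,
    curvOfSpray (geoCoeff F) i k x y =
      K x y * ((F x y)^2 * (if i = k then (1:ℝ) else 0)
        - y i * ∑ j, fundTensor F x y k j * y j)

/-- Conditions (E1)–(E3). -/
def E123 {n : ℕ} (U : Set (Vec n)) (a : Vec n → Matrix (Fin n) (Fin n) ℝ)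
    (b : Vec n → Vec n) (τ lam : Vec n → ℝ) : Prop :=
  (∀ x ∈ U, ∀ i j : Fin n, covDeriv a b i j x =
      τ x * ((1 + 2 * bsq a b x) * a x i j - 3 * b x i * b x j)) ∧
  (∀ x ∈ U, ∀ y : Vec n, ∀ i k : Fin n,
      curvOfSpray (sprayOf a) i k x y =
        lam x * ((alphaOf a x y)^2 * (if i = k then (1:ℝ) else 0)
            - y i * (∑ j, a x k j * y j))
        + 2 * (lam x + 4 * (2 + bsq a b x) * (τ x)^2) *
          ((betaOf b x y)^2 * (if i = k then (1:ℝ) else 0)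
            + (alphaOf a x y)^2 * (∑ j, (a x)⁻¹ i j * b x j) * b x k
            - betaOf b x y * (∑ j, (a x)⁻¹ i j * b x j) * (∑ j, a x k j * y j)
            - betaOf b x y * b x k * y i)) ∧
  (∀ x ∈ U, ∀ i : Fin n, pd τ i x =
      (-(7 + 4 * bsq a b x) * (τ x)^2 - lam x) * b x i)

/-- The standard metric of constant sectional curvature `μ`:
`h_{ij}(x) = ((1+μ|x|²)δ_{ij} − μx_ix_j)/(1+μ|x|²)²`. -/
def hMat {n : ℕ} (μ : ℝ) (x : Vec n) : Matrix (Fin n) (Fin n) ℝ :=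
  Matrix.of fun i j =>
    ((1 + μ * ∑ l, (x l)^2) * (if i = j then (1:ℝ) else 0) - μ * x i * x j)
      / (1 + μ * ∑ l, (x l)^2)^2

/-- `h_μ(x,y) = √((1+μ|x|²)|y|² − μ⟨x,y⟩²)/(1+μ|x|²)`. -/
def hmu {n : ℕ} (μ : ℝ) (x y : Vec n) : ℝ :=
  Real.sqrt ((1 + μ * ∑ l, (x l)^2) * (∑ l, (y l)^2) - μ * (∑ l, x l * y l)^2)
    / (1 + μ * ∑ l, (x l)^2)

/-- `σ(x) = √([k²+(1+|a|²)μ]|x|² + (2k − μ⟨a,x⟩)⟨a,x⟩ + |a|² + 1)`. -/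
def sigmaFun {n : ℕ} (μ k : ℝ) (a : Vec n) (x : Vec n) : ℝ :=
  Real.sqrt ((k^2 + (1 + ∑ l, (a l)^2) * μ) * (∑ l, (x l)^2)
    + (2 * k - μ * ∑ l, a l * x l) * (∑ l, a l * x l) + (∑ l, (a l)^2) + 1)

/-- `f` is differentiable at `x` and its derivative in the direction `v` is `d`. -/
def HasDirDeriv {n : ℕ} (f : Vec n → ℝ) (x v : Vec n) (d : ℝ) : Prop :=
  DifferentiableAt ℝ f x ∧ fderiv ℝ f x v = d

namespace HasDirDeriv

variable {n : ℕ} {f g : Vec n → ℝ} {x v : Vec n} {d e : ℝ}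

theorem congr_deriv (hf : HasDirDeriv f x v d) (h : d = e) : HasDirDeriv f x v e := h ▸ hf

theorem congr_of_eventuallyEq (hf : HasDirDeriv f x v d) (h : g =ᶠ[nhds x] f) :
    HasDirDeriv g x v d :=
  ⟨hf.1.congr_of_eventuallyEq h, by rw [h.fderiv_eq]; exact hf.2⟩

theorem congr_of_mem {U : Set (Vec n)} (hU : IsOpen U) (hx : x ∈ U)
    (hf : HasDirDeriv f x v d) (h : ∀ z ∈ U, g z = f z) : HasDirDeriv g x v d :=
  hf.congr_of_eventuallyEq (Filter.eventually_of_mem (hU.mem_nhds hx) h)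

theorem const (r : ℝ) : HasDirDeriv (fun _ => r) x v 0 :=
  ⟨differentiableAt_const r, by simp⟩

theorem linear (L : Vec n →ₗ[ℝ] ℝ) : HasDirDeriv (fun z => L z) x v (L v) := by
  have := (LinearMap.toContinuousLinearMap L).hasFDerivAt (x := x)
  exact ⟨this.differentiableAt, congrArg (fun M : Vec n →L[ℝ] ℝ => M v) this.fderiv⟩

theorem add (hf : HasDirDeriv f x v d) (hg : HasDirDeriv g x v e) :
    HasDirDeriv (fun z => f z + g z) x v (d + e) :=
  ⟨hf.1.add hg.1, by rw [fderiv_fun_add hf.1 hg.1]; simp [hf.2, hg.2]⟩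

theorem sub (hf : HasDirDeriv f x v d) (hg : HasDirDeriv g x v e) :
    HasDirDeriv (fun z => f z - g z) x v (d - e) :=
  ⟨hf.1.sub hg.1, by rw [fderiv_fun_sub hf.1 hg.1]; simp [hf.2, hg.2]⟩

theorem mul (hf : HasDirDeriv f x v d) (hg : HasDirDeriv g x v e) :
    HasDirDeriv (fun z => f z * g z) x v (d * g x + f x * e) :=
  ⟨hf.1.mul hg.1, by rw [fderiv_fun_mul hf.1 hg.1]; simp [hf.2, hg.2]; ring⟩

theorem const_mul (r : ℝ) (hf : HasDirDeriv f x v d) :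
    HasDirDeriv (fun z => r * f z) x v (r * d) :=
  ((const r).mul hf).congr_deriv (by ring)

theorem comp {φ : ℝ → ℝ} {φ' : ℝ} (hφ : HasDerivAt φ φ' (f x)) (hf : HasDirDeriv f x v d) :
    HasDirDeriv (fun z => φ (f z)) x v (φ' * d) := by
  have := hφ.comp_hasFDerivAt x hf.1.hasFDerivAt
  exact ⟨this.differentiableAt, by
    rw [show (fun z => φ (f z)) = φ ∘ f from rfl, this.fderiv]; simp [hf.2]⟩

theorem pow (m : ℕ) (hf : HasDirDeriv f x v d) :
    HasDirDeriv (fun z => f z ^ m) x v (m * f x ^ (m - 1) * d) :=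
  comp (hasDerivAt_pow m (f x)) hf

theorem div (hf : HasDirDeriv f x v d) (hg : HasDirDeriv g x v e) (h : g x ≠ 0) :
    HasDirDeriv (fun z => f z / g z) x v ((d * g x - f x * e) / g x ^ 2) := by
  have := hf.mul (comp (hasDerivAt_inv h) hg)
  simp only [← div_eq_mul_inv] at this
  exact this.congr_deriv (by field_simp; ring)

theorem sqrt (hf : HasDirDeriv f x v d) (h : f x ≠ 0) :
    HasDirDeriv (fun z => √(f z)) x v (d / (2 * √(f x))) :=
  (comp (Real.hasDerivAt_sqrt h) hf).congr_deriv (by ring)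

theorem sum {ι : Type*} {s : Finset ι} {F : ι → Vec n → ℝ} {D : ι → ℝ}
    (h : ∀ i ∈ s, HasDirDeriv (F i) x v (D i)) :
    HasDirDeriv (fun z => ∑ i ∈ s, F i z) x v (∑ i ∈ s, D i) :=
  ⟨DifferentiableAt.fun_sum fun i hi => (h i hi).1, by
    rw [fderiv_fun_sum fun i hi => (h i hi).1]
    simp only [FunLike.coe_sum, Finset.sum_apply]
    exact Finset.sum_congr rfl fun i hi => (h i hi).2⟩

theorem apply (i : Fin n) : HasDirDeriv (fun z : Vec n => z i) x v (v i) :=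
  linear (LinearMap.proj i)

end HasDirDeriv

theorem linearMap_eq_sum {n : ℕ} (L : Vec n →ₗ[ℝ] ℝ) (v : Vec n) :
    ∑ k, v k * L (Pi.single k 1) = L v := by
  rw [LinearMap.pi_apply_eq_sum_univ L v]
  refine Finset.sum_congr rfl fun k _ => ?_
  rw [smul_eq_mul]
  congr 2
  ext j
  simp [Pi.single_apply, eq_comm]

theorem sum_mul_fderiv_single {n : ℕ} (f : Vec n → ℝ) (x v : Vec n) :
    ∑ k, v k * fderiv ℝ f x (Pi.single k 1) = fderiv ℝ f x v :=
  linearMap_eq_sum (fderiv ℝ f x).toLinearMap v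

theorem hasDirDeriv_of_pd {n : ℕ} {f : Vec n → ℝ} {x : Vec n} (L : Vec n →ₗ[ℝ] ℝ)
    (hf : DifferentiableAt ℝ f x) (h : ∀ k, pd f k x = L (Pi.single k 1)) (v : Vec n) :
    HasDirDeriv f x v (L v) := by
  refine ⟨hf, ?_⟩
  rw [← sum_mul_fderiv_single, ← linearMap_eq_sum L]
  exact Finset.sum_congr rfl fun k _ => by rw [← h k, pd]

/-- The differential system, on an open set `U`, satisfied by a projectively flat metric `h` of
constant curvature `μ` with connection form `Q`, a closed conformal 1-form `B` of factor `c`, and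
a potential `w` with `w ∇w = c B`. -/
structure ConformalSystem {n : ℕ} (μ : ℝ) (U : Set (Vec n)) (Q B : Vec n → Vec n →ₗ[ℝ] ℝ)
    (h : Vec n → Vec n →ₗ[ℝ] Vec n →ₗ[ℝ] ℝ) (c w : Vec n → ℝ) : Prop where
  isOpen : IsOpen U
  symm : ∀ x ∈ U, ∀ y z, h x y z = h x z y
  pos : ∀ x ∈ U, ∀ y, y ≠ 0 → 0 < h x y y
  w_pos : ∀ x ∈ U, 0 < w x
  B_sq_lt : ∀ x ∈ U, ∀ y, y ≠ 0 → B x y ^ 2 < w x ^ 2 * h x y y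
  deriv_Q : ∀ x ∈ U, ∀ y v, HasDirDeriv (fun x => Q x y) x v (Q x y * Q x v - μ * h x y v)
  deriv_h : ∀ x ∈ U, ∀ y z v, HasDirDeriv (fun x => h x y z) x v
    (2 * Q x v * h x y z + Q x y * h x z v + Q x z * h x y v)
  deriv_B : ∀ x ∈ U, ∀ y v, HasDirDeriv (fun x => B x y) x v
    (Q x y * B x v + Q x v * B x y + c x * h x y v)
  deriv_c : ∀ x ∈ U, ∀ v, HasDirDeriv c x v (-μ * B x v)
  deriv_w : ∀ x ∈ U, ∀ v, HasDirDeriv w x v (c x / w x * B x v)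

theorem HasDirDeriv.bilin_self {n : ℕ} (b : Vec n →ₗ[ℝ] Vec n →ₗ[ℝ] ℝ) (y v : Vec n) :
    HasDirDeriv (fun y => b y y) y v (b y v + b v y) := by
  have key : ∀ y, b y y = ∑ k, y k * b.flip (Pi.single k 1) y := fun y => by
    simpa using (linearMap_eq_sum (b y) y).symm
  simp_rw [key]
  refine (HasDirDeriv.sum fun k _ =>
    (HasDirDeriv.apply k).mul (HasDirDeriv.linear (b.flip (Pi.single k 1)))).congr_deriv ?_
  simp [Finset.sum_add_distrib, linearMap_eq_sum]

namespace ConformalSystem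

variable {n : ℕ} {μ : ℝ} {U : Set (Vec n)} {Q B : Vec n → Vec n →ₗ[ℝ] ℝ}
  {h : Vec n → Vec n →ₗ[ℝ] Vec n →ₗ[ℝ] ℝ} {c w : Vec n → ℝ}

/-- The norm of `y` with respect to `h x`. -/
def rad (h : Vec n → Vec n →ₗ[ℝ] Vec n →ₗ[ℝ] ℝ) (x y : Vec n) : ℝ := √(h x y y)

/-- The ratio of the 1-form `B` to the norm of `h`. -/
def ratio (B : Vec n → Vec n →ₗ[ℝ] ℝ) (h : Vec n → Vec n →ₗ[ℝ] Vec n →ₗ[ℝ] ℝ)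
    (x y : Vec n) : ℝ := B x y / rad h x y

/-- The projective factor of the square metric. -/
def projFactor (Q : Vec n → Vec n →ₗ[ℝ] ℝ) (h : Vec n → Vec n →ₗ[ℝ] Vec n →ₗ[ℝ] ℝ)
    (c w : Vec n → ℝ) (x y : Vec n) : ℝ := Q x y + c x / w x * rad h x y

/-- The fiber derivative of `F²` in the direction `p`, for the square metric `F`. -/
def sqDeriv (B : Vec n → Vec n →ₗ[ℝ] ℝ) (h : Vec n → Vec n →ₗ[ℝ] Vec n →ₗ[ℝ] ℝ)
    (w : Vec n → ℝ) (x y p : Vec n) : ℝ :=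
  2 * (w x + ratio B h x y) ^ 3 *
    ((w x - ratio B h x y) * h x y p + 2 * (rad h x y * B x p))

/-- The fiber derivative of `ratio` in the direction `p`. -/
def ratioDeriv (B : Vec n → Vec n →ₗ[ℝ] ℝ) (h : Vec n → Vec n →ₗ[ℝ] Vec n →ₗ[ℝ] ℝ)
    (x y p : Vec n) : ℝ :=
  (B x p - ratio B h x y * h x y p / rad h x y) / rad h x y

/-- The fundamental tensor of the square metric, as a bilinear expression. -/
def fundForm (B : Vec n → Vec n →ₗ[ℝ] ℝ) (h : Vec n → Vec n →ₗ[ℝ] Vec n →ₗ[ℝ] ℝ)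
    (w : Vec n → ℝ) (x y p q : Vec n) : ℝ :=
  3 * (w x + ratio B h x y) ^ 2 * ratioDeriv B h x y p *
      ((w x - ratio B h x y) * h x y q + 2 * (rad h x y * B x q)) +
    (w x + ratio B h x y) ^ 3 * (-ratioDeriv B h x y p * h x y q +
      (w x - ratio B h x y) * h x p q + 2 * (h x y p / rad h x y * B x q))

theorem rad_pos (S : ConformalSystem μ U Q B h c w) {x y : Vec n} (hx : x ∈ U) (hy : y ≠ 0) :
    0 < rad h x y := Real.sqrt_pos.2 (S.pos x hx y hy)

theorem rad_sq (S : ConformalSystem μ U Q B h c w) {x y : Vec n} (hx : x ∈ U) (hy : y ≠ 0) :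
    rad h x y ^ 2 = h x y y := Real.sq_sqrt (S.pos x hx y hy).le

theorem ratio_mul_rad (S : ConformalSystem μ U Q B h c w) {x y : Vec n} (hx : x ∈ U)
    (hy : y ≠ 0) : B x y = ratio B h x y * rad h x y :=
  (div_mul_cancel₀ _ (S.rad_pos hx hy).ne').symm

theorem abs_ratio_lt (S : ConformalSystem μ U Q B h c w) {x y : Vec n} (hx : x ∈ U)
    (hy : y ≠ 0) : |ratio B h x y| < w x := by
  refine abs_lt_of_sq_lt_sq ?_ (S.w_pos x hx).le
  have h1 := S.B_sq_lt x hx y hy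
  rw [S.ratio_mul_rad hx hy, ← S.rad_sq hx hy, mul_pow] at h1
  exact lt_of_mul_lt_mul_right h1 (sq_nonneg _)

theorem add_ratio_pos (S : ConformalSystem μ U Q B h c w) {x y : Vec n} (hx : x ∈ U)
    (hy : y ≠ 0) : 0 < w x + ratio B h x y := by
  linarith [(abs_lt.1 (S.abs_ratio_lt hx hy)).1]

theorem sub_ratio_pos (S : ConformalSystem μ U Q B h c w) {x y : Vec n} (hx : x ∈ U)
    (hy : y ≠ 0) : 0 < w x - ratio B h x y := by
  linarith [(abs_lt.1 (S.abs_ratio_lt hx hy)).2]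

theorem deriv_rad (S : ConformalSystem μ U Q B h c w) {x y : Vec n} (hx : x ∈ U) (hy : y ≠ 0)
    (v : Vec n) : HasDirDeriv (fun x => rad h x y) x v
      (Q x v * rad h x y + Q x y * h x y v / rad h x y) := by
  refine ((S.deriv_h x hx y y v).sqrt (S.pos x hx y hy).ne').congr_deriv ?_
  have := S.rad_pos hx hy
  change _ / (2 * rad h x y) = _
  rw [← S.rad_sq hx hy]
  field_simp
  ring

theorem deriv_rad_fiber (S : ConformalSystem μ U Q B h c w) {x y : Vec n} (hx : x ∈ U)
    (hy : y ≠ 0) (v : Vec n) :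
    HasDirDeriv (fun y => rad h x y) y v (h x y v / rad h x y) := by
  refine ((HasDirDeriv.bilin_self (h x) y v).sqrt (S.pos x hx y hy).ne').congr_deriv ?_
  rw [S.symm x hx v y]
  change _ / (2 * rad h x y) = _
  ring

theorem deriv_ratio (S : ConformalSystem μ U Q B h c w) {x y : Vec n} (hx : x ∈ U) (hy : y ≠ 0)
    (v : Vec n) : HasDirDeriv (fun x => ratio B h x y) x v
      (Q x y * ratioDeriv B h x y v + c x * h x y v / rad h x y) := by
  have := S.rad_pos hx hy
  refine ((S.deriv_B x hx y v).div (S.deriv_rad hx hy v) this.ne').congr_deriv ?_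
  rw [ratioDeriv, S.ratio_mul_rad hx hy]
  field_simp
  ring

theorem deriv_ratio_fiber (S : ConformalSystem μ U Q B h c w) {x y : Vec n} (hx : x ∈ U)
    (hy : y ≠ 0) (v : Vec n) :
    HasDirDeriv (fun y => ratio B h x y) y v (ratioDeriv B h x y v) := by
  have := S.rad_pos hx hy
  refine ((HasDirDeriv.linear (B x)).div (S.deriv_rad_fiber hx hy v) this.ne').congr_deriv ?_
  rw [ratioDeriv, S.ratio_mul_rad hx hy]
  field_simp

/-- The square metric written through `h`, `B` and `w`. -/
def squareMetric (B : Vec n → Vec n →ₗ[ℝ] ℝ) (h : Vec n → Vec n →ₗ[ℝ] Vec n →ₗ[ℝ] ℝ)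
    (w : Vec n → ℝ) (x y : Vec n) : ℝ := rad h x y * (w x + ratio B h x y) ^ 2

theorem deriv_sq_fiber (S : ConformalSystem μ U Q B h c w) {x y : Vec n} (hx : x ∈ U)
    (hy : y ≠ 0) (v : Vec n) :
    HasDirDeriv (fun y => squareMetric B h w x y ^ 2) y v (sqDeriv B h w x y v) := by
  have := S.rad_pos hx hy
  refine (((S.deriv_rad_fiber hx hy v).mul
    (((HasDirDeriv.const (w x)).add (S.deriv_ratio_fiber hx hy v)).pow 2)).pow 2).congr_deriv ?_
  rw [sqDeriv, ratioDeriv]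
  field_simp
  ring

theorem deriv_sq (S : ConformalSystem μ U Q B h c w) {x y : Vec n} (hx : x ∈ U)
    (hy : y ≠ 0) (v : Vec n) :
    HasDirDeriv (fun x => squareMetric B h w x y ^ 2) x v
      (2 * (Q x v + c x / w x * (h x y v / rad h x y)) * squareMetric B h w x y ^ 2 +
        projFactor Q h c w x y * sqDeriv B h w x y v) := by
  have := S.rad_pos hx hy
  have := S.w_pos x hx
  refine (((S.deriv_rad hx hy v).mul
    (((S.deriv_w x hx v).add (S.deriv_ratio hx hy v)).pow 2)).pow 2).congr_deriv ?_
  rw [sqDeriv, ratioDeriv, squareMetric, projFactor]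
  field_simp
  ring

theorem deriv_sqDeriv_fiber (S : ConformalSystem μ U Q B h c w) {x y : Vec n} (hx : x ∈ U)
    (hy : y ≠ 0) (p q : Vec n) :
    HasDirDeriv (fun y => sqDeriv B h w x y q) y p (2 * fundForm B h w x y p q) := by
  have hr := S.deriv_rad_fiber hx hy p
  have ht := S.deriv_ratio_fiber hx hy p
  have hw : HasDirDeriv (fun _ : Vec n => w x) y p 0 := HasDirDeriv.const (w x)
  have hq : HasDirDeriv (fun y => h x y q) y p (h x p q) := HasDirDeriv.linear ((h x).flip q)
  refine ((((hw.add ht).pow 3).const_mul 2).mul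
    (((hw.sub ht).mul hq).add ((hr.mul (HasDirDeriv.const (B x q))).const_mul 2))).congr_deriv ?_
  rw [fundForm]
  push_cast
  ring

theorem deriv_sqDeriv (S : ConformalSystem μ U Q B h c w) {x y : Vec n} (hx : x ∈ U)
    (hy : y ≠ 0) (p : Vec n) :
    HasDirDeriv (fun x => sqDeriv B h w x y p) x y
      (3 * projFactor Q h c w x y * sqDeriv B h w x y p +
        2 * (Q x p + c x / w x * (h x y p / rad h x y)) * squareMetric B h w x y ^ 2) := by
  have hr := S.deriv_rad hx hy y
  have ht := S.deriv_ratio hx hy y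
  have hw := S.deriv_w x hx y
  have := S.rad_pos hx hy
  have := S.w_pos x hx
  refine ((((hw.add ht).pow 3).const_mul 2).mul (((hw.sub ht).mul (S.deriv_h x hx y p y)).add
    ((hr.mul (S.deriv_B x hx p y)).const_mul 2))).congr_deriv ?_
  rw [sqDeriv, ratioDeriv, squareMetric, projFactor, S.symm x hx p y, ← S.rad_sq hx hy,
    S.ratio_mul_rad hx hy]
  field_simp
  ring

theorem sum_fundForm_right (x y p q : Vec n) :
    ∑ j, q j * fundForm B h w x y p (Pi.single j 1) = fundForm B h w x y p q := by
  let L : Vec n →ₗ[ℝ] ℝ :=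
    (3 * (w x + ratio B h x y) ^ 2 * ratioDeriv B h x y p) •
        ((w x - ratio B h x y) • h x y + (2 * rad h x y) • B x) +
      (w x + ratio B h x y) ^ 3 • (-ratioDeriv B h x y p • h x y +
        (w x - ratio B h x y) • h x p + (2 * (h x y p / rad h x y)) • B x)
  have hL : ∀ q, fundForm B h w x y p q = L q := fun q => by simp [L, fundForm]; ring
  simp_rw [hL]
  exact linearMap_eq_sum L q

theorem sum_fundForm_left (x y p q : Vec n) :
    ∑ i, p i * fundForm B h w x y (Pi.single i 1) q = fundForm B h w x y p q := by
  let T : Vec n →ₗ[ℝ] ℝ :=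
    (1 / rad h x y) • (B x - (ratio B h x y / rad h x y) • h x y)
  let L : Vec n →ₗ[ℝ] ℝ :=
    (3 * (w x + ratio B h x y) ^ 2 *
        ((w x - ratio B h x y) * h x y q + 2 * (rad h x y * B x q))) • T +
      (w x + ratio B h x y) ^ 3 • (-h x y q • T +
        (w x - ratio B h x y) • (h x).flip q + (2 * (B x q / rad h x y)) • h x y)
  have hL : ∀ p, fundForm B h w x y p q = L p := fun p => by
    simp [L, T, fundForm, ratioDeriv]; ring
  simp_rw [hL]
  exact linearMap_eq_sum L p

theorem fundForm_self_right (S : ConformalSystem μ U Q B h c w) {x y : Vec n} (hx : x ∈ U)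
    (hy : y ≠ 0) (p : Vec n) : fundForm B h w x y p y = sqDeriv B h w x y p / 2 := by
  have := S.rad_pos hx hy
  rw [fundForm, sqDeriv, ratioDeriv, S.symm x hx p y, ← S.rad_sq hx hy, S.ratio_mul_rad hx hy]
  field_simp
  ring

theorem fundForm_diag (S : ConformalSystem μ U Q B h c w) {x y : Vec n} (hx : x ∈ U)
    (hy : y ≠ 0) (p : Vec n) : fundForm B h w x y p p =
      ((w x + ratio B h x y) * ((w x - ratio B h x y) * h x y p / rad h x y + 2 * B x p)) ^ 2 +
      (w x + ratio B h x y) ^ 2 * ((w x + ratio B h x y) * (w x - ratio B h x y) *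
        (h x p p - (h x y p / rad h x y) ^ 2) +
        2 * (rad h x y * ratioDeriv B h x y p) ^ 2) := by
  have := S.rad_pos hx hy
  rw [fundForm, ratioDeriv]
  field_simp
  ring

theorem cauchySchwarz_defect (S : ConformalSystem μ U Q B h c w) {x y : Vec n} (hx : x ∈ U)
    (hy : y ≠ 0) (p : Vec n) :
    h x (h x y y • p - h x y p • y) (h x y y • p - h x y p • y) =
      rad h x y ^ 4 * (h x p p - (h x y p / rad h x y) ^ 2) := by
  have := S.rad_pos hx hy
  simp only [map_sub, map_smul, LinearMap.sub_apply, LinearMap.smul_apply, smul_eq_mul,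
    S.symm x hx p y, ← S.rad_sq hx hy]
  field_simp
  ring

theorem eq_zero_of_fundForm_eq_zero (S : ConformalSystem μ U Q B h c w) {x y : Vec n}
    (hx : x ∈ U) (hy : y ≠ 0) {p : Vec n} (hp : fundForm B h w x y p p = 0) : p = 0 := by
  have hr := S.rad_pos hx hy
  have hu := S.add_ratio_pos hx hy
  have hd := S.sub_ratio_pos hx hy
  rw [S.fundForm_diag hx hy] at hp
  have hdef := S.cauchySchwarz_defect hx hy p
  set D := h x p p - (h x y p / rad h x y) ^ 2 with hD
  set z := h x y y • p - h x y p • y with hz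
  have hD0 : 0 ≤ D := by
    have : 0 ≤ h x z z := by
      rcases eq_or_ne z 0 with h0 | h0
      · simp [h0]
      · exact (S.pos x hx z h0).le
    rw [hdef] at this
    exact nonneg_of_mul_nonneg_right this (by positivity)
  have h1 : 0 ≤ (w x + ratio B h x y) ^ 2 * ((w x + ratio B h x y) * (w x - ratio B h x y) *
        D + 2 * (rad h x y * ratioDeriv B h x y p) ^ 2) := by positivity
  have h2 := (add_eq_zero_iff_of_nonneg (sq_nonneg _) h1).1 hp
  have h3 : D = 0 := by
    have h4 := (mul_eq_zero.1 h2.2).resolve_left (by positivity)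
    have h5 := ((add_eq_zero_iff_of_nonneg (by positivity) (by positivity)).1 h4).1
    exact (mul_eq_zero.1 h5).resolve_left (by positivity)
  have hz0 : z = 0 := by
    by_contra h0
    have := S.pos x hx z h0
    rw [hdef, h3] at this
    simp at this
  have hyy := S.pos x hx y hy
  have hpy : p = (h x y p / h x y y) • y := by
    have h4 : h x y y • p = h x y p • y := sub_eq_zero.1 hz0
    rw [div_eq_inv_mul, mul_smul, ← h4, smul_smul, inv_mul_cancel₀ hyy.ne', one_smul]
  set k := h x y p / h x y y
  have h4 := (mul_eq_zero.1 (pow_eq_zero_iff (two_ne_zero)|>.1 h2.1)).resolve_left hu.ne'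
  rw [hpy] at h4
  simp only [map_smul, smul_eq_mul, ← S.rad_sq hx hy, S.ratio_mul_rad hx hy] at h4
  have h5 : k * (rad h x y * (w x + ratio B h x y)) = 0 := by
    rw [← h4]; field_simp; ring
  have h6 : k = 0 := (mul_eq_zero.1 h5).resolve_right (by positivity)
  rw [hpy, h6, zero_smul]

variable {F : Vec n → Vec n → ℝ}

theorem hasDirDeriv_sq_fiber (S : ConformalSystem μ U Q B h c w)
    (hF : ∀ x ∈ U, ∀ y, y ≠ 0 → F x y = squareMetric B h w x y) {x y : Vec n} (hx : x ∈ U)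
    (hy : y ≠ 0) (v : Vec n) :
    HasDirDeriv (fun y => F x y ^ 2) y v (sqDeriv B h w x y v) :=
  (S.deriv_sq_fiber hx hy v).congr_of_mem isOpen_compl_singleton hy
    fun z hz => by rw [hF x hx z hz]

theorem fundTensor_eq (S : ConformalSystem μ U Q B h c w)
    (hF : ∀ x ∈ U, ∀ y, y ≠ 0 → F x y = squareMetric B h w x y) {x y : Vec n} (hx : x ∈ U)
    (hy : y ≠ 0) (i j : Fin n) :
    fundTensor F x y i j = fundForm B h w x y (Pi.single i 1) (Pi.single j 1) := by
  have := (S.deriv_sqDeriv_fiber hx hy (Pi.single i 1) (Pi.single j 1)).congr_of_mem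
    (g := fun y => pdy (fun x y => F x y ^ 2) j x y) isOpen_compl_singleton hy
    fun z hz => (S.hasDirDeriv_sq_fiber hF hx hz _).2
  rw [fundTensor, Matrix.of_apply, pdy, this.2]
  ring

theorem sum_fundTensor_mul (S : ConformalSystem μ U Q B h c w)
    (hF : ∀ x ∈ U, ∀ y, y ≠ 0 → F x y = squareMetric B h w x y) {x y : Vec n} (hx : x ∈ U)
    (hy : y ≠ 0) (i : Fin n) (v : Vec n) :
    ∑ j, fundTensor F x y i j * v j = fundForm B h w x y (Pi.single i 1) v := by
  rw [← sum_fundForm_right]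
  exact Finset.sum_congr rfl fun j _ => by rw [S.fundTensor_eq hF hx hy, mul_comm]

theorem isUnit_det_fundTensor (S : ConformalSystem μ U Q B h c w)
    (hF : ∀ x ∈ U, ∀ y, y ≠ 0 → F x y = squareMetric B h w x y) {x y : Vec n} (hx : x ∈ U)
    (hy : y ≠ 0) : IsUnit (fundTensor F x y).det := by
  rw [isUnit_iff_ne_zero]
  intro h0
  obtain ⟨v, hv, hv0⟩ := Matrix.exists_mulVec_eq_zero_iff.2 h0
  refine hv (S.eq_zero_of_fundForm_eq_zero hx hy ?_)
  rw [← sum_fundForm_left]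
  refine Finset.sum_eq_zero fun i _ => ?_
  rw [← S.sum_fundTensor_mul hF hx hy]
  exact mul_eq_zero_of_right _ (congrFun hv0 i)

theorem geoCoeff_eq (S : ConformalSystem μ U Q B h c w)
    (hF : ∀ x ∈ U, ∀ y, y ≠ 0 → F x y = squareMetric B h w x y) {x y : Vec n} (hx : x ∈ U)
    (hy : y ≠ 0) (i : Fin n) : geoCoeff F i x y = projFactor Q h c w x y * y i := by
  have key : ∀ l, (∑ k, y k * pdx (fun x y => pdy (fun x y => F x y ^ 2) l x y) k x y)
      - pdx (fun x y => F x y ^ 2) l x y =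
      4 * projFactor Q h c w x y * (fundTensor F x y).mulVec y l := fun l => by
    have h1 := (S.deriv_sqDeriv hx hy (Pi.single l 1)).congr_of_mem
      (g := fun x => pdy (fun x y => F x y ^ 2) l x y) S.isOpen hx
      fun z hz => (S.hasDirDeriv_sq_fiber hF hz hy _).2
    have h2 := (S.deriv_sq hx hy (Pi.single l 1)).congr_of_mem
      (g := fun x => F x y ^ 2) S.isOpen hx fun z hz => by rw [hF z hz y hy]
    simp only [pdx]
    rw [sum_mul_fderiv_single, h1.2, h2.2]
    have h3 : (fundTensor F x y).mulVec y l = _ := S.sum_fundTensor_mul hF hx hy l y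
    rw [h3, S.fundForm_self_right hx hy]
    ring
  rw [geoCoeff]
  simp_rw [key]
  have h4 : (fundTensor F x y)⁻¹.mulVec ((fundTensor F x y).mulVec y) = y := by
    rw [Matrix.mulVec_mulVec, Matrix.nonsing_inv_mul _ (S.isUnit_det_fundTensor hF hx hy),
      Matrix.one_mulVec]
  have h5 : ∑ l, (fundTensor F x y)⁻¹ i l * (fundTensor F x y).mulVec y l = y i :=
    congrFun h4 i
  conv_rhs => rw [← h5]
  rw [Finset.mul_sum, Finset.mul_sum]
  exact Finset.sum_congr rfl fun l _ => by ring

/-- The fiber derivative of `projFactor`. -/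
def projDeriv (Q : Vec n → Vec n →ₗ[ℝ] ℝ) (h : Vec n → Vec n →ₗ[ℝ] Vec n →ₗ[ℝ] ℝ)
    (c w : Vec n → ℝ) (x y : Vec n) : Vec n →ₗ[ℝ] ℝ :=
  Q x + (c x / w x / rad h x y) • h x y

theorem projDeriv_apply (x y p : Vec n) :
    projDeriv Q h c w x y p = Q x p + c x / w x * (h x y p / rad h x y) := by
  simp [projDeriv]
  ring

theorem projDeriv_self (S : ConformalSystem μ U Q B h c w) {x y : Vec n} (hx : x ∈ U)
    (hy : y ≠ 0) : projDeriv Q h c w x y y = projFactor Q h c w x y := by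
  have := S.rad_pos hx hy
  rw [projDeriv_apply, projFactor, ← S.rad_sq hx hy]
  field_simp

theorem deriv_projFactor_fiber (S : ConformalSystem μ U Q B h c w) {x y : Vec n} (hx : x ∈ U)
    (hy : y ≠ 0) (v : Vec n) :
    HasDirDeriv (fun y => projFactor Q h c w x y) y v (projDeriv Q h c w x y v) := by
  rw [projDeriv_apply]
  exact (HasDirDeriv.linear (Q x)).add ((S.deriv_rad_fiber hx hy v).const_mul _)

theorem deriv_projFactor (S : ConformalSystem μ U Q B h c w) {x y : Vec n} (hx : x ∈ U)
    (hy : y ≠ 0) (v : Vec n) :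
    HasDirDeriv (fun x => projFactor Q h c w x y) x v
      (Q x y * Q x v - μ * h x y v
        - (μ + (c x / w x) ^ 2) * (B x v / w x) * rad h x y
        + c x / w x * (Q x v * rad h x y + Q x y * h x y v / rad h x y)) := by
  have := S.rad_pos hx hy
  have := S.w_pos x hx
  refine ((S.deriv_Q x hx y v).add (((S.deriv_c x hx v).div (S.deriv_w x hx v) this.ne').mul
    (S.deriv_rad hx hy v))).congr_deriv ?_
  field_simp
  ring

theorem deriv_projDeriv_fiber (S : ConformalSystem μ U Q B h c w) {x y : Vec n} (hx : x ∈ U)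
    (hy : y ≠ 0) (p : Vec n) :
    HasDirDeriv (fun y => projDeriv Q h c w x y p) y y 0 := by
  have hr := S.rad_pos hx hy
  have hp : HasDirDeriv (fun y => h x y p) y y (h x y p) := HasDirDeriv.linear ((h x).flip p)
  simp_rw [projDeriv_apply]
  refine ((HasDirDeriv.const (Q x p)).add ((hp.div (S.deriv_rad_fiber hx hy y)
    hr.ne').const_mul (c x / w x))).congr_deriv ?_
  rw [← S.rad_sq hx hy]
  field_simp
  ring

theorem deriv_projDeriv (S : ConformalSystem μ U Q B h c w) {x y : Vec n} (hx : x ∈ U)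
    (hy : y ≠ 0) (p : Vec n) :
    HasDirDeriv (fun x => projDeriv Q h c w x y p) x y
      (Q x y * Q x p - μ * h x y p
        - (μ + (c x / w x) ^ 2) * (B x y / w x) * (h x y p / rad h x y)
        + c x / w x * (Q x p * rad h x y + Q x y * h x y p / rad h x y)) := by
  have hr := S.rad_pos hx hy
  have := S.w_pos x hx
  simp_rw [projDeriv_apply]
  refine ((S.deriv_Q x hx p y).add (((S.deriv_c x hx y).div (S.deriv_w x hx y) this.ne').mul
    ((S.deriv_h x hx y p y).div (S.deriv_rad hx hy y) hr.ne'))).congr_deriv ?_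
  rw [S.symm x hx p y, ← S.rad_sq hx hy]
  field_simp
  ring

theorem single_apply_eq (i k : Fin n) :
    (Pi.single k (1 : ℝ) : Vec n) i = if i = k then 1 else 0 := by
  simp [Pi.single_apply]

/-- The curvature of a projectively flat spray `Gⁱ = P yⁱ`. -/
theorem curvOfSpray_eq (S : ConformalSystem μ U Q B h c w) {G : Fin n → Vec n → Vec n → ℝ}
    (hG : ∀ x ∈ U, ∀ y, y ≠ 0 → ∀ i, G i x y = projFactor Q h c w x y * y i) {x y : Vec n}
    (hx : x ∈ U) (hy : y ≠ 0) (i k : Fin n) :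
    curvOfSpray G i k x y = (μ + (c x / w x) ^ 2) / w x *
      (rad h x y ^ 2 * (w x + ratio B h x y) * (if i = k then 1 else 0) -
        y i * ((w x - ratio B h x y) * h x y (Pi.single k 1) +
          2 * (rad h x y * B x (Pi.single k 1)))) := by
  have hpdy : ∀ x ∈ U, ∀ y, y ≠ 0 → ∀ i k, pdy (G i) k x y =
      projDeriv Q h c w x y (Pi.single k 1) * y i +
        projFactor Q h c w x y * (Pi.single k (1 : ℝ) : Vec n) i :=
    fun x hx y hy i k =>
      (((S.deriv_projFactor_fiber hx hy _).mul (HasDirDeriv.apply i)).congr_of_mem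
        isOpen_compl_singleton hy fun z hz => hG x hx z hz i).2
  have hpdx : pdx (G i) k x y = _ :=
    (((S.deriv_projFactor hx hy (Pi.single k 1)).mul (HasDirDeriv.const (y i))).congr_of_mem
      S.isOpen hx fun z hz => hG z hz y hy i).2
  have hxy := (((S.deriv_projDeriv hx hy (Pi.single k 1)).mul (HasDirDeriv.const (y i))).add
    ((S.deriv_projFactor hx hy y).mul
      (HasDirDeriv.const ((Pi.single k (1 : ℝ) : Vec n) i)))).congr_of_mem
      (g := fun x => pdy (G i) k x y) S.isOpen hx fun z hz => hpdy z hz y hy i k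
  have hyy := (((S.deriv_projDeriv_fiber hx hy (Pi.single k 1)).mul
    (HasDirDeriv.apply i)).add ((S.deriv_projFactor_fiber hx hy y).mul
      (HasDirDeriv.const ((Pi.single k (1 : ℝ) : Vec n) i)))).congr_of_mem
      (g := fun y => pdy (G i) k x y) isOpen_compl_singleton hy
      fun z hz => hpdy x hx z hz i k
  have hsum1 : ∑ j, y j * pdx (fun x y => pdy (G i) k x y) j x y = _ :=
    (sum_mul_fderiv_single (fun x => pdy (G i) k x y) x y).trans hxy.2
  have hsum2 : ∑ j, G j x y * pdy (fun x y => pdy (G i) k x y) j x y =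
      projFactor Q h c w x y * (fderiv ℝ (fun y => pdy (G i) k x y) y y) := by
    rw [← sum_mul_fderiv_single, Finset.mul_sum]
    refine Finset.sum_congr rfl fun j _ => ?_
    rw [hG x hx y hy, mul_assoc]
    rfl
  have hsum3 : ∑ j, pdy (G i) j x y * pdy (G j) k x y =
      projFactor Q h c w x y * (3 * projDeriv Q h c w x y (Pi.single k 1) * y i +
        projFactor Q h c w x y * (Pi.single k (1 : ℝ) : Vec n) i) := by
    have h1 := linearMap_eq_sum
      (y i • projDeriv Q h c w x y + projFactor Q h c w x y • LinearMap.proj i)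
      (projDeriv Q h c w x y (Pi.single k 1) • y +
        projFactor Q h c w x y • (Pi.single k 1 : Vec n))
    have h2 := S.projDeriv_self hx hy
    simp only [LinearMap.add_apply, LinearMap.smul_apply, map_add, map_smul, smul_eq_mul,
      LinearMap.proj_apply, h2, Pi.add_apply, Pi.smul_apply] at h1
    refine Eq.trans (Finset.sum_congr rfl fun j _ => ?_) (h1.trans (by ring))
    rw [hpdy x hx y hy, hpdy x hx y hy]
    ring
  rw [curvOfSpray, hpdx, hsum1, hsum2, hyy.2, hsum3, S.projDeriv_self hx hy,
    ← single_apply_eq i k, projDeriv_apply, projFactor, ← S.rad_sq hx hy,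
    S.ratio_mul_rad hx hy]
  have := S.rad_pos hx hy
  have := S.w_pos x hx
  field_simp
  ring

theorem curvOfSpray_geoCoeff (S : ConformalSystem μ U Q B h c w) {F : Vec n → Vec n → ℝ}
    (hF : ∀ x ∈ U, ∀ y, y ≠ 0 → F x y = squareMetric B h w x y) {x y : Vec n} (hx : x ∈ U)
    (hy : y ≠ 0) (i k : Fin n) :
    curvOfSpray (geoCoeff F) i k x y =
      (c x ^ 2 + μ * w x ^ 2) / (w x * (w x + ratio B h x y)) ^ 3 *
        (F x y ^ 2 * (if i = k then 1 else 0) - y i * ∑ j, fundTensor F x y k j * y j) := by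
  rw [S.curvOfSpray_eq (fun x hx y hy i => S.geoCoeff_eq hF hx hy i) hx hy,
    S.sum_fundTensor_mul hF hx hy, S.fundForm_self_right hx hy, hF x hx y hy, sqDeriv,
    squareMetric]
  have := S.w_pos x hx
  have := S.add_ratio_pos hx hy
  field_simp
  ring

end ConformalSystem

/-- The linear form with coefficients `p`. -/
def linForm {n : ℕ} (p : Vec n) : Vec n →ₗ[ℝ] ℝ := ∑ i, p i • LinearMap.proj i

theorem linForm_apply {n : ℕ} (p v : Vec n) : linForm p v = ∑ i, p i * v i := by
  simp [linForm]

theorem linForm_comm {n : ℕ} (p v : Vec n) : linForm p v = linForm v p := by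
  simp only [linForm_apply, mul_comm]

theorem linForm_single {n : ℕ} (p : Vec n) (i : Fin n) : linForm p (Pi.single i 1) = p i := by
  simp [linForm_apply, Pi.single_apply]

theorem linForm_add {n : ℕ} (p q v : Vec n) :
    linForm (p + q) v = linForm p v + linForm q v := by
  simp only [linForm_comm _ v, map_add]

theorem linForm_smul {n : ℕ} (r : ℝ) (p v : Vec n) :
    linForm (r • p) v = r * linForm p v := by
  simp only [linForm_comm _ v, map_smul, smul_eq_mul]

theorem linForm_self_pos {n : ℕ} {y : Vec n} (hy : y ≠ 0) : 0 < linForm y y := by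
  obtain ⟨i, hi⟩ := Function.ne_iff.1 hy
  rw [linForm_apply]
  exact Finset.sum_pos' (fun j _ => mul_self_nonneg _)
    ⟨i, Finset.mem_univ i, mul_self_pos.2 hi⟩

theorem linForm_sq_le {n : ℕ} (x y : Vec n) :
    linForm x y ^ 2 ≤ linForm x x * linForm y y := by
  simp only [linForm_apply, ← sq]
  exact Finset.sum_mul_sq_le_sq_mul_sq _ _ _

namespace SpaceForm

variable {n : ℕ}

/-- The factor `1 + μ|x|²`. -/
def om (μ : ℝ) (x : Vec n) : ℝ := 1 + μ * ∑ l, x l ^ 2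

theorem om_eq (μ : ℝ) (x : Vec n) : om μ x = 1 + μ * linForm x x := by
  simp only [om, linForm_apply, sq]

/-- The connection form of the projectively flat coordinates of a space form. -/
def conn (μ : ℝ) (x : Vec n) : Vec n →ₗ[ℝ] ℝ := (-μ / om μ x) • linForm x

theorem conn_apply (μ : ℝ) (x v : Vec n) : conn μ x v = -μ * linForm x v / om μ x := by
  simp [conn]
  ring

/-- The space form metric of curvature `μ` as a bilinear form. -/
def metric (μ : ℝ) (x : Vec n) : Vec n →ₗ[ℝ] Vec n →ₗ[ℝ] ℝ :=
  LinearMap.mk₂ ℝ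
    (fun y z => linForm y z / om μ x - μ * (linForm x y * linForm x z) / om μ x ^ 2)
    (fun y y' z => by simp only [linForm_add, map_add]; ring)
    (fun r y z => by simp only [linForm_smul, map_smul, smul_eq_mul]; ring)
    (fun y z z' => by simp only [map_add]; ring)
    (fun r y z => by simp only [map_smul, smul_eq_mul]; ring)

theorem metric_apply (μ : ℝ) (x y z : Vec n) : metric μ x y z =
    linForm y z / om μ x - μ * (linForm x y * linForm x z) / om μ x ^ 2 := rfl

theorem metric_symm (μ : ℝ) (x y z : Vec n) : metric μ x y z = metric μ x z y := by
  rw [metric_apply, metric_apply, linForm_comm y z]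
  ring

theorem metric_single {μ : ℝ} {x : Vec n} (hx : 0 < om μ x) (i j : Fin n) :
    metric μ x (Pi.single i 1) (Pi.single j 1) = hMat μ x i j := by
  rw [metric_apply, hMat, Matrix.of_apply]
  change _ = (om μ x * _ - _) / om μ x ^ 2
  rw [linForm_single, linForm_single, linForm_single, Pi.single_apply]
  simp only [eq_comm (a := j)]
  field_simp

theorem sum_hMat_mul {μ : ℝ} {x : Vec n} (hx : 0 < om μ x) (y z : Vec n) :
    ∑ i, ∑ j, hMat μ x i j * y i * z j = metric μ x y z := by
  have h1 := linearMap_eq_sum ((metric μ x).flip z) y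
  rw [LinearMap.flip_apply] at h1
  rw [← h1]
  refine Finset.sum_congr rfl fun i _ => ?_
  rw [LinearMap.flip_apply, ← linearMap_eq_sum, Finset.mul_sum]
  exact Finset.sum_congr rfl fun j _ => by rw [metric_single hx]; ring

theorem metric_pos {μ : ℝ} {x : Vec n} (hx : 0 < om μ x) {y : Vec n} (hy : y ≠ 0) :
    0 < metric μ x y y := by
  have h1 := linForm_self_pos hy
  have h2 : metric μ x y y =
      (om μ x * linForm y y - μ * linForm x y ^ 2) / om μ x ^ 2 := by
    rw [metric_apply]
    field_simp
  rw [h2]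
  refine div_pos ?_ (by positivity)
  rcases le_or_gt μ 0 with hμ | hμ
  · have : 0 < om μ x * linForm y y := by positivity
    nlinarith [mul_nonneg (neg_nonneg.2 hμ) (sq_nonneg (linForm x y))]
  · rw [om_eq]
    nlinarith [mul_le_mul_of_nonneg_left (linForm_sq_le x y) hμ.le]

theorem deriv_linForm (x y v : Vec n) :
    HasDirDeriv (fun x => linForm x y) x v (linForm v y) := by
  simp only [linForm_comm _ y]
  exact HasDirDeriv.linear _

theorem deriv_om {μ : ℝ} {x : Vec n} (hx : 0 < om μ x) (v : Vec n) :
    HasDirDeriv (om μ) x v (-2 * om μ x * conn μ x v) := by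
  have h1 : HasDirDeriv (om μ) x v (0 + μ * ∑ l, (2 : ℕ) * x l ^ (2 - 1) * v l) :=
    (HasDirDeriv.const 1).add
      ((HasDirDeriv.sum fun l _ => (HasDirDeriv.apply l).pow 2).const_mul μ)
  refine h1.congr_deriv ?_
  rw [conn_apply, linForm_apply]
  field_simp
  rw [zero_add, Finset.mul_sum, Finset.mul_sum]
  exact Finset.sum_congr rfl fun l _ => by push_cast; ring

theorem deriv_conn {μ : ℝ} {x : Vec n} (hx : 0 < om μ x) (y v : Vec n) :
    HasDirDeriv (fun x => conn μ x y) x v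
      (conn μ x y * conn μ x v - μ * metric μ x y v) := by
  simp only [conn_apply]
  refine (((deriv_linForm x y v).const_mul (-μ)).div (deriv_om hx v) hx.ne').congr_deriv ?_
  rw [conn_apply, metric_apply, linForm_comm v y]
  field_simp
  ring

theorem deriv_metric {μ : ℝ} {x : Vec n} (hx : 0 < om μ x) (y z v : Vec n) :
    HasDirDeriv (fun x => metric μ x y z) x v
      (2 * conn μ x v * metric μ x y z + conn μ x y * metric μ x z v +
        conn μ x z * metric μ x y v) := by
  simp only [metric_apply]
  refine (((HasDirDeriv.const (linForm y z)).div (deriv_om hx v) hx.ne').sub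
    ((((deriv_linForm x y v).mul (deriv_linForm x z v)).const_mul μ).div
      ((deriv_om hx v).pow 2) (by positivity))).congr_deriv ?_
  simp only [conn_apply, linForm_comm v]
  push_cast
  field_simp
  ring

/-- The vector dual to the linear form `p` with respect to the space form metric. -/
def sharp (μ : ℝ) (x p : Vec n) : Vec n := om μ x • (p + (μ * linForm x p) • x)

theorem metric_sharp {μ : ℝ} {x : Vec n} (hx : 0 < om μ x) (p z : Vec n) :
    metric μ x (sharp μ x p) z = linForm p z := by
  have h1 := om_eq μ x
  rw [metric_apply, sharp]
  simp only [linForm_smul, linForm_add, map_smul, map_add, smul_eq_mul]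
  have h2 : μ * linForm x x = om μ x - 1 := by linarith
  field_simp
  linear_combination (-μ * linForm x p * linForm x z) * h2

theorem inv_hMat_apply {μ : ℝ} {x : Vec n} (hx : 0 < om μ x) (i j : Fin n) :
    (hMat μ x)⁻¹ i j = sharp μ x (Pi.single i 1) j := by
  have h1 : hMat μ x * (Matrix.of fun i j => sharp μ x (Pi.single j 1) i) = 1 := by
    ext i k
    have h2 := metric_sharp hx (Pi.single k 1) (Pi.single i 1)
    rw [metric_symm, ← linearMap_eq_sum, linForm_single] at h2
    rw [Matrix.mul_apply, Matrix.one_apply]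
    simp only [Matrix.of_apply, ← metric_single hx]
    rw [← Pi.single_apply k (1 : ℝ) i, ← h2]
    exact Finset.sum_congr rfl fun _ _ => mul_comm _ _
  rw [Matrix.inv_eq_right_inv h1, Matrix.of_apply]
  simp only [sharp, Pi.smul_apply, Pi.add_apply, smul_eq_mul, linForm_single, Pi.single_apply,
    eq_comm (a := i)]
  ring

theorem sum_mul_inv_hMat {μ : ℝ} {x : Vec n} (hx : 0 < om μ x) (p : Vec n) (l : Fin n) :
    ∑ k, p k * (hMat μ x)⁻¹ k l = sharp μ x p l := by
  let L : Vec n →ₗ[ℝ] ℝ := om μ x • (LinearMap.proj l + (μ * x l) • linForm x)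
  have hL : ∀ p, sharp μ x p l = L p := fun p => by
    simp [L, sharp]; ring
  simp only [inv_hMat_apply hx, hL]
  exact linearMap_eq_sum L p

theorem linForm_sharp (μ : ℝ) (x p : Vec n) :
    linForm p (sharp μ x p) = om μ x * (linForm p p + μ * linForm x p ^ 2) := by
  simp only [sharp, map_smul, map_add, smul_eq_mul, linForm_comm p x]
  ring

theorem conn_sharp {μ : ℝ} {x : Vec n} (hx : 0 < om μ x) (p : Vec n) :
    conn μ x (sharp μ x p) = -μ * om μ x * linForm x p := by
  rw [conn_apply]
  simp only [sharp, map_smul, map_add, smul_eq_mul]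
  field_simp
  rw [om_eq]
  ring

theorem deriv_linForm_sharp {μ : ℝ} {x v : Vec n} (hx : 0 < om μ x) {p : Vec n → Vec n}
    {D : Vec n → ℝ} (hp : ∀ y, HasDirDeriv (fun x => linForm (p x) y) x v (D y)) :
    HasDirDeriv (fun x => linForm (p x) (sharp μ x (p x))) x v
      (2 * D (sharp μ x (p x)) - 2 * conn μ x v * linForm (p x) (sharp μ x (p x)) -
        2 * conn μ x (sharp μ x (p x)) * linForm (p x) v) := by
  have h1 : ∀ i, HasDirDeriv (fun x => p x i) x v (D (Pi.single i 1)) := fun i => by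
    simpa only [linForm_single] using hp (Pi.single i 1)
  let q : Vec n := fun i => D (Pi.single i 1)
  have h2 : ∀ y, D y = linForm q y := fun y => by
    have h := HasDirDeriv.sum (s := Finset.univ) fun i _ => (h1 i).mul (HasDirDeriv.const (y i))
    simp only [mul_zero, add_zero, ← linForm_apply (p _)] at h
    rw [← (hp y).2, h.2, linForm_apply]
  have h3 : HasDirDeriv (fun x => linForm (p x) (p x)) x v (2 * D (p x)) := by
    have h := HasDirDeriv.sum (s := Finset.univ) fun i _ => (h1 i).mul (h1 i)
    simp only [← linForm_apply (p _)] at h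
    refine h.congr_deriv ?_
    rw [h2, linForm_apply, Finset.mul_sum]
    exact Finset.sum_congr rfl fun i _ => by simp only [q]; ring
  have h4 : HasDirDeriv (fun x => linForm x (p x)) x v (linForm (p x) v + D x) := by
    have h := HasDirDeriv.sum (s := Finset.univ) fun i _ =>
      (HasDirDeriv.apply (v := v) i).mul (h1 i)
    refine HasDirDeriv.congr_deriv (f := fun x => linForm x (p x))
      (by simpa only [linForm_apply] using h) ?_
    rw [h2, linForm_comm _ v, linForm_comm _ x, linForm_apply, linForm_apply,
      Finset.sum_add_distrib]
  have h5 := (deriv_om hx v).mul (h3.add ((h4.pow 2).const_mul μ))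
  simp only [← linForm_sharp] at h5
  refine h5.congr_deriv ?_
  rw [conn_sharp hx, h2, h2, h2, linForm_sharp]
  simp only [sharp, map_smul, map_add, smul_eq_mul]
  push_cast
  ring

end SpaceForm

open SpaceForm

/-- A metric `a` and a 1-form `b` satisfying the covariant derivative condition of a projectively
flat square metric, such that `(1 - b²)² a` is the space form metric of curvature `μ`. -/
structure SquareData {n : ℕ} (μ : ℝ) (U : Set (Vec n)) (a : Vec n → Matrix (Fin n) (Fin n) ℝ)
    (b : Vec n → Vec n) (τ : Vec n → ℝ) : Prop where
  isOpen : IsOpen U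
  om_pos : ∀ x ∈ U, 0 < om μ x
  contDiff_b : ∀ i, ContDiffOn ℝ (⊤ : ℕ∞) (fun x => b x i) U
  contDiff_tau : ContDiffOn ℝ (⊤ : ℕ∞) τ U
  contDiff_s : ContDiffOn ℝ (⊤ : ℕ∞) (fun x => 1 - bsq a b x) U
  s_pos : ∀ x ∈ U, 0 < 1 - bsq a b x
  conformal : ∀ x ∈ U, ∀ i j, (1 - bsq a b x) ^ 2 * a x i j = hMat μ x i j
  cov : ∀ x ∈ U, ∀ i j, covDeriv a b i j x =
    τ x * ((1 + 2 * bsq a b x) * a x i j - 3 * b x i * b x j)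

theorem ContDiffOn.differentiableAt_of_isOpen {n : ℕ} {U : Set (Vec n)} {f : Vec n → ℝ}
    (hf : ContDiffOn ℝ (⊤ : ℕ∞) f U) (hU : IsOpen U) {x : Vec n} (hx : x ∈ U) :
    DifferentiableAt ℝ f x :=
  ((hf x hx).contDiffAt (hU.mem_nhds hx)).differentiableAt (by simp)

namespace SquareData

variable {n : ℕ} {μ : ℝ} {U : Set (Vec n)} {a : Vec n → Matrix (Fin n) (Fin n) ℝ}
  {b : Vec n → Vec n} {τ : Vec n → ℝ}

theorem a_eq (S : SquareData μ U a b τ) {x : Vec n} (hx : x ∈ U) (i j : Fin n) :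
    a x i j = metric μ x (Pi.single i 1) (Pi.single j 1) / (1 - bsq a b x) ^ 2 := by
  have := S.s_pos x hx
  rw [metric_single (S.om_pos x hx), ← S.conformal x hx]
  field_simp

theorem inv_a (S : SquareData μ U a b τ) {x : Vec n} (hx : x ∈ U) :
    (a x)⁻¹ = (1 - bsq a b x) ^ 2 • (hMat μ x)⁻¹ := by
  have hs := S.s_pos x hx
  have h1 : IsUnit (hMat μ x).det := by
    rw [isUnit_iff_ne_zero]
    intro h0
    obtain ⟨v, hv, hv0⟩ := Matrix.exists_mulVec_eq_zero_iff.2 h0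
    refine (metric_pos (S.om_pos x hx) hv).ne' ?_
    rw [← sum_hMat_mul (S.om_pos x hx)]
    refine Finset.sum_eq_zero fun i _ => ?_
    have h2 : ∑ j, hMat μ x i j * v j = 0 := congrFun hv0 i
    calc ∑ j, hMat μ x i j * v i * v j = v i * ∑ j, hMat μ x i j * v j := by
          rw [Finset.mul_sum]
          exact Finset.sum_congr rfl fun j _ => by ring
      _ = 0 := by rw [h2, mul_zero]
  have h2 : a x = ((1 - bsq a b x) ^ 2)⁻¹ • hMat μ x := by
    ext i j
    rw [Matrix.smul_apply, ← S.conformal x hx, smul_eq_mul]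
    field_simp
  refine Matrix.inv_eq_right_inv ?_
  conv_lhs => rw [h2]
  rw [Matrix.smul_mul, Matrix.mul_smul, Matrix.mul_nonsing_inv _ h1, smul_smul,
    inv_mul_cancel₀ (by positivity), one_smul]

theorem sum_mul_inv_a (S : SquareData μ U a b τ) {x : Vec n} (hx : x ∈ U) (l : Fin n) :
    ∑ k, b x k * (a x)⁻¹ k l = (1 - bsq a b x) ^ 2 * sharp μ x (b x) l := by
  rw [← sum_mul_inv_hMat (S.om_pos x hx), S.inv_a hx, Finset.mul_sum]
  refine Finset.sum_congr rfl fun k _ => ?_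
  rw [Matrix.smul_apply, smul_eq_mul]
  ring

theorem bsq_eq (S : SquareData μ U a b τ) {x : Vec n} (hx : x ∈ U) :
    bsq a b x = (1 - bsq a b x) ^ 2 * linForm (b x) (sharp μ x (b x)) := by
  conv_lhs => rw [bsq, Finset.sum_comm]
  rw [linForm_apply, Finset.mul_sum]
  refine Finset.sum_congr rfl fun l _ => ?_
  rw [← Finset.sum_mul, mul_left_comm, ← S.sum_mul_inv_a hx, mul_comm]
  congr 1
  exact Finset.sum_congr rfl fun k _ => mul_comm _ _

theorem hasDirDeriv_s (S : SquareData μ U a b τ) {x : Vec n} (hx : x ∈ U) (v : Vec n) :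
    HasDirDeriv (fun x => 1 - bsq a b x) x v
      ((fderiv ℝ (fun x => 1 - bsq a b x) x).toLinearMap v) :=
  ⟨S.contDiff_s.differentiableAt_of_isOpen S.isOpen hx, rfl⟩

theorem pd_a (S : SquareData μ U a b τ) {x : Vec n} (hx : x ∈ U) (i j k : Fin n)
    {ds : Vec n →ₗ[ℝ] ℝ} (hds : ∀ v, HasDirDeriv (fun x => 1 - bsq a b x) x v (ds v)) :
    pd (fun x => a x i j) k x =
      (2 * conn μ x (Pi.single k 1) * metric μ x (Pi.single i 1) (Pi.single j 1) +
        conn μ x (Pi.single i 1) * metric μ x (Pi.single j 1) (Pi.single k 1) +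
        conn μ x (Pi.single j 1) * metric μ x (Pi.single i 1) (Pi.single k 1))
          / (1 - bsq a b x) ^ 2 -
      2 * ds (Pi.single k 1) * metric μ x (Pi.single i 1) (Pi.single j 1)
        / (1 - bsq a b x) ^ 3 := by
  have hs := S.s_pos x hx
  have h1 := ((deriv_metric (S.om_pos x hx) (Pi.single i 1) (Pi.single j 1)
    (Pi.single k 1)).div ((hds (Pi.single k 1)).pow 2) (by positivity)).congr_of_mem
    (g := fun x => a x i j) S.isOpen hx fun z hz => S.a_eq hz i j
  rw [pd, h1.2]
  push_cast
  field_simp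

theorem sum_mul_christoffel (S : SquareData μ U a b τ) {x : Vec n} (hx : x ∈ U) (i j : Fin n)
    {ds : Vec n →ₗ[ℝ] ℝ} (hds : ∀ v, HasDirDeriv (fun x => 1 - bsq a b x) x v (ds v)) :
    ∑ k, b x k * christoffel a k i j x =
      conn μ x (Pi.single j 1) * b x i + conn μ x (Pi.single i 1) * b x j -
        (ds (Pi.single j 1) * b x i + ds (Pi.single i 1) * b x j -
          ds (sharp μ x (b x)) * metric μ x (Pi.single i 1) (Pi.single j 1))
            / (1 - bsq a b x) := by
  have hs := S.s_pos x hx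
  set s := 1 - bsq a b x with hsdef
  set y : Vec n := Pi.single i 1
  set v : Vec n := Pi.single j 1
  let L : Vec n →ₗ[ℝ] ℝ :=
    conn μ x v • (metric μ x).flip y + conn μ x y • (metric μ x).flip v -
      s⁻¹ • (ds v • (metric μ x).flip y + ds y • (metric μ x).flip v - metric μ x y v • ds)
  have h1 : ∀ l, (1 / 2) * s ^ 2 * (pd (fun x => a x l i) j x + pd (fun x => a x l j) i x -
      pd (fun x => a x i j) l x) = L (Pi.single l 1) := fun l => by
    rw [S.pd_a hx _ _ _ hds, S.pd_a hx _ _ _ hds, S.pd_a hx _ _ _ hds]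
    simp only [L, LinearMap.sub_apply, LinearMap.add_apply, LinearMap.smul_apply, smul_eq_mul,
      LinearMap.flip_apply, ← hsdef]
    rw [metric_symm μ x (Pi.single j 1) (Pi.single i 1),
      metric_symm μ x (Pi.single i 1) (Pi.single l 1),
      metric_symm μ x (Pi.single j 1) (Pi.single l 1)]
    field_simp
    ring
  have h2 := linearMap_eq_sum L (sharp μ x (b x))
  have h3 : L (sharp μ x (b x)) =
      conn μ x v * linForm (b x) y + conn μ x y * linForm (b x) v -
        s⁻¹ * (ds v * linForm (b x) y + ds y * linForm (b x) v -
          metric μ x y v * ds (sharp μ x (b x))) := by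
    simp only [L, LinearMap.sub_apply, LinearMap.add_apply, LinearMap.smul_apply, smul_eq_mul,
      LinearMap.flip_apply, metric_sharp (S.om_pos x hx)]
  rw [← linForm_single (b x) i, ← linForm_single (b x) j,
    show ∀ p q : ℝ, p - q / s = p - s⁻¹ * q from fun p q => by ring,
    mul_comm (ds (sharp μ x (b x))), ← h3, ← h2]
  simp only [christoffel, Finset.mul_sum]
  rw [Finset.sum_comm]
  refine Finset.sum_congr rfl fun l _ => ?_
  rw [← h1 l, show ∀ q : ℝ, sharp μ x (b x) l * (1 / 2 * s ^ 2 * q) =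
    (1 / 2 * q) * (s ^ 2 * sharp μ x (b x) l) from fun q => by ring, ← S.sum_mul_inv_a hx,
    Finset.mul_sum]
  exact Finset.sum_congr rfl fun k _ => by ring

theorem deriv_b_aux (S : SquareData μ U a b τ) {x : Vec n} (hx : x ∈ U)
    {ds : Vec n →ₗ[ℝ] ℝ} (hds : ∀ v, HasDirDeriv (fun x => 1 - bsq a b x) x v (ds v))
    (y v : Vec n) :
    HasDirDeriv (fun x => linForm (b x) y) x v
      (conn μ x v * linForm (b x) y + conn μ x y * linForm (b x) v -
        (ds v * linForm (b x) y + ds y * linForm (b x) v -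
          ds (sharp μ x (b x)) * metric μ x y v) / (1 - bsq a b x) +
        τ x * ((1 + 2 * bsq a b x) * metric μ x y v / (1 - bsq a b x) ^ 2 -
          3 * linForm (b x) y * linForm (b x) v)) := by
  have hs := S.s_pos x hx
  set s := 1 - bsq a b x with hsdef
  let M : Vec n →ₗ[ℝ] Vec n →ₗ[ℝ] ℝ :=
    LinearMap.mk₂ ℝ (fun y v => conn μ x v * linForm (b x) y + conn μ x y * linForm (b x) v -
        (ds v * linForm (b x) y + ds y * linForm (b x) v -
          ds (sharp μ x (b x)) * metric μ x y v) / s +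
        τ x * ((1 + 2 * bsq a b x) * metric μ x y v / s ^ 2 -
          3 * linForm (b x) y * linForm (b x) v))
      (fun _ _ _ => by simp only [map_add, LinearMap.add_apply]; ring)
      (fun _ _ _ => by simp only [map_smul, LinearMap.smul_apply, smul_eq_mul]; ring)
      (fun _ _ _ => by simp only [map_add]; ring)
      (fun _ _ _ => by simp only [map_smul, smul_eq_mul]; ring)
  have h1 : ∀ i, HasDirDeriv (fun x => b x i) x v (M (Pi.single i 1) v) := fun i => by
    refine hasDirDeriv_of_pd _ ((S.contDiff_b i).differentiableAt_of_isOpen S.isOpen hx)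
      (fun j => ?_) v
    have h2 := S.cov x hx i j
    rw [covDeriv, S.sum_mul_christoffel hx i j hds, S.a_eq hx, sub_eq_iff_eq_add] at h2
    rw [h2]
    simp only [M, LinearMap.mk₂_apply, linForm_single, ← hsdef]
    ring
  have h3 := HasDirDeriv.sum (s := Finset.univ) fun i _ => (h1 i).mul (HasDirDeriv.const (y i))
  simp only [← linForm_apply (b _), mul_zero, add_zero] at h3
  refine h3.congr_deriv ?_
  calc ∑ i, M (Pi.single i 1) v * y i = ∑ i, y i * M.flip v (Pi.single i 1) :=
        Finset.sum_congr rfl fun i _ => mul_comm _ _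
    _ = _ := linearMap_eq_sum (M.flip v) y

theorem deriv_s (S : SquareData μ U a b τ) {x : Vec n} (hx : x ∈ U) (v : Vec n) :
    HasDirDeriv (fun x => 1 - bsq a b x) x v
      (-2 * τ x * (1 - bsq a b x) * linForm (b x) v) := by
  have hs := S.s_pos x hx
  have hN := S.bsq_eq hx
  have hds := S.hasDirDeriv_s hx
  generalize (fderiv ℝ (fun x => 1 - bsq a b x) x).toLinearMap = ds at hds
  refine (hds v).congr_deriv ?_
  have h1 := deriv_linForm_sharp (S.om_pos x hx) fun y => S.deriv_b_aux hx hds y v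
  have h2 := ((HasDirDeriv.const 1).sub (((hds v).pow 2).mul h1)).congr_of_mem S.isOpen hx
    (g := fun x => 1 - bsq a b x) fun z hz => by rw [← S.bsq_eq hz]
  have h3 := (hds v).2.symm.trans h2.2
  rw [metric_sharp (S.om_pos x hx)] at h3
  generalize linForm (b x) (sharp μ x (b x)) = N at *
  generalize linForm (b x) v = bv at *
  push_cast at h3
  set s := 1 - bsq a b x with hsdef
  have hb : bsq a b x = 1 - s := by rw [hsdef]; ring
  rw [hb] at h3 hN
  have hN' : N = (1 - s) / s ^ 2 := by rw [hN]; field_simp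
  rw [hN'] at h3
  field_simp at h3
  refine mul_right_cancel₀ hs.ne' ?_
  linear_combination h3

theorem deriv_b (S : SquareData μ U a b τ) {x : Vec n} (hx : x ∈ U) (y v : Vec n) :
    HasDirDeriv (fun x => linForm (b x) y) x v
      (conn μ x v * linForm (b x) y + conn μ x y * linForm (b x) v +
        τ x * (linForm (b x) y * linForm (b x) v) +
        τ x / (1 - bsq a b x) ^ 2 * metric μ x y v) := by
  have hs := S.s_pos x hx
  have hN := S.bsq_eq hx
  have hds := S.hasDirDeriv_s hx
  have h : ∀ v, (fderiv ℝ (fun x => 1 - bsq a b x) x).toLinearMap v =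
    -2 * τ x * (1 - bsq a b x) * linForm (b x) v := fun v => (S.deriv_s hx v).2
  refine (S.deriv_b_aux hx hds y v).congr_deriv ?_
  simp only [h]
  generalize linForm (b x) (sharp μ x (b x)) = N at *
  set s := 1 - bsq a b x with hsdef
  have hb : bsq a b x = 1 - s := by rw [hsdef]; ring
  rw [hb] at hN ⊢
  have hN' : N = (1 - s) / s ^ 2 := by rw [hN]; field_simp
  rw [hN']
  field_simp
  ring

end SquareData

theorem sndDeriv_symm {n : ℕ} {f : Vec n → ℝ} {x : Vec n} (hf : ContDiffAt ℝ 2 f x)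
    {D : Vec n → Vec n → ℝ} (hD : ∀ v, ∀ᶠ z in nhds x, fderiv ℝ f z v = D v z)
    {E : Vec n → Vec n → ℝ} (hE : ∀ u v, HasDirDeriv (D v) x u (E u v)) (u v : Vec n) :
    E u v = E v u := by
  have h1 : DifferentiableAt ℝ (fderiv ℝ f) x :=
    (hf.fderiv_right (m := 1) (by norm_num)).differentiableAt (by norm_num)
  have h2 : ∀ u v, E u v = fderiv ℝ (fderiv ℝ f) x u v := fun u v => by
    rw [← ((hE u v).congr_of_eventuallyEq (hD v)).2,
      fderiv_clm_apply h1 (differentiableAt_const v)]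
    simp
  rw [h2, h2]
  exact hf.isSymmSndFDerivAt (by simp) u v

theorem exists_ne_zero_of_linForm {n : ℕ} [Nontrivial (Fin n)] (θ : Vec n →ₗ[ℝ] ℝ) :
    ∃ z, z ≠ 0 ∧ θ z = 0 := by
  obtain ⟨i, j, hij⟩ := exists_pair_ne (Fin n)
  by_cases h : θ (Pi.single i 1) = 0
  · exact ⟨Pi.single i 1, by simp, h⟩
  · refine ⟨θ (Pi.single i 1) • Pi.single j 1 - θ (Pi.single j 1) • Pi.single i 1, ?_, ?_⟩
    · intro h0
      have := congrFun h0 j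
      simp [hij.symm] at this
      exact h this
    · simp only [map_sub, map_smul, smul_eq_mul]
      ring

/-- The factor of a closed conformal 1-form of a space form has derivative `-μ B`. -/
theorem deriv_conformalFactor {n : ℕ} [Nontrivial (Fin n)] {μ : ℝ} {U : Set (Vec n)}
    {Q B : Vec n → Vec n →ₗ[ℝ] ℝ} {h : Vec n → Vec n →ₗ[ℝ] Vec n →ₗ[ℝ] ℝ} {c : Vec n → ℝ}
    (hU : IsOpen U) {x : Vec n} (hx : x ∈ U)
    (symm : ∀ y z, h x y z = h x z y) (pos : ∀ y, y ≠ 0 → 0 < h x y y)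
    (deriv_Q : ∀ y v, HasDirDeriv (fun x => Q x y) x v (Q x y * Q x v - μ * h x y v))
    (deriv_h : ∀ y z v, HasDirDeriv (fun x => h x y z) x v
      (2 * Q x v * h x y z + Q x y * h x z v + Q x z * h x y v))
    (deriv_B : ∀ x ∈ U, ∀ y v, HasDirDeriv (fun x => B x y) x v
      (Q x y * B x v + Q x v * B x y + c x * h x y v))
    (contDiff_B : ∀ y, ContDiffAt ℝ 2 (fun x => B x y) x)
    (diff_c : DifferentiableAt ℝ c x) (v : Vec n) :
    HasDirDeriv c x v (-μ * B x v) := by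
  have hc : ∀ v, HasDirDeriv c x v (fderiv ℝ c x v) := fun v => ⟨diff_c, rfl⟩
  have key : ∀ y u v, (fderiv ℝ c x u + μ * B x u) * h x y v =
      (fderiv ℝ c x v + μ * B x v) * h x y u := fun y u v => by
    have h1 := sndDeriv_symm (contDiff_B y)
      (fun v => Filter.eventually_of_mem (hU.mem_nhds hx) fun z hz => (deriv_B z hz y v).2)
      (fun u v => (((deriv_Q y u).mul (deriv_B x hx v u)).add
        ((deriv_Q v u).mul (deriv_B x hx y u))).add ((hc u).mul (deriv_h y v u))) u v
    rw [symm v u] at h1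
    linear_combination h1
  let θ : Vec n →ₗ[ℝ] ℝ := (fderiv ℝ c x).toLinearMap + μ • B x
  obtain ⟨z, hz, hz0⟩ := exists_ne_zero_of_linForm θ
  have hz1 : fderiv ℝ c x z + μ * B x z = 0 := hz0
  have h2 := key z v z
  rw [hz1, zero_mul] at h2
  have h3 := (mul_eq_zero.1 h2).resolve_right (pos z hz).ne'
  exact (hc v).congr_deriv (by linarith)

namespace SquareData

variable {n : ℕ} {μ : ℝ} {U : Set (Vec n)} {a : Vec n → Matrix (Fin n) (Fin n) ℝ}
  {b : Vec n → Vec n} {τ : Vec n → ℝ}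

/-- The potential `(1 - b²)^(-1/2)`. -/
def potential (a : Vec n → Matrix (Fin n) (Fin n) ℝ) (b : Vec n → Vec n) (x : Vec n) : ℝ :=
  (√(1 - bsq a b x))⁻¹

/-- The closed conformal 1-form `(1 - b²)^(1/2) β`. -/
def conformalForm (a : Vec n → Matrix (Fin n) (Fin n) ℝ) (b : Vec n → Vec n) (x : Vec n) :
    Vec n →ₗ[ℝ] ℝ :=
  √(1 - bsq a b x) • linForm (b x)

/-- The conformal factor of `conformalForm`. -/
def factor (a : Vec n → Matrix (Fin n) (Fin n) ℝ) (b : Vec n → Vec n) (τ : Vec n → ℝ)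
    (x : Vec n) : ℝ :=
  τ x * √(1 - bsq a b x) / (1 - bsq a b x) ^ 2

theorem potential_sq (S : SquareData μ U a b τ) {x : Vec n} (hx : x ∈ U) :
    potential a b x ^ 2 = (1 - bsq a b x)⁻¹ := by
  rw [potential, inv_pow, Real.sq_sqrt (S.s_pos x hx).le]

theorem potential_pos (S : SquareData μ U a b τ) {x : Vec n} (hx : x ∈ U) :
    0 < potential a b x :=
  inv_pos.2 (Real.sqrt_pos.2 (S.s_pos x hx))

theorem potential_mul_conformalForm (S : SquareData μ U a b τ) {x : Vec n} (hx : x ∈ U)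
    (y : Vec n) : potential a b x * conformalForm a b x y = linForm (b x) y := by
  have := Real.sqrt_pos.2 (S.s_pos x hx)
  rw [potential, conformalForm, LinearMap.smul_apply, smul_eq_mul]
  field_simp

theorem metric_eq_sq_mul (S : SquareData μ U a b τ) {x : Vec n} (hx : x ∈ U) (y : Vec n) :
    ∑ i, ∑ j, a x i j * y i * y j = (potential a b x ^ 2) ^ 2 * metric μ x y y := by
  have hs := S.s_pos x hx
  rw [S.potential_sq hx, ← sum_hMat_mul (S.om_pos x hx), Finset.mul_sum]
  refine Finset.sum_congr rfl fun i _ => ?_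
  rw [Finset.mul_sum]
  refine Finset.sum_congr rfl fun j _ => ?_
  rw [← S.conformal x hx]
  field_simp

theorem deriv_potential (S : SquareData μ U a b τ) {x : Vec n} (hx : x ∈ U) (v : Vec n) :
    HasDirDeriv (potential a b) x v
      (factor a b τ x / potential a b x * conformalForm a b x v) := by
  have hs := S.s_pos x hx
  have hr := Real.sqrt_pos.2 hs
  have hr2 := Real.sq_sqrt hs.le
  have h := (HasDirDeriv.const 1).div ((S.deriv_s hx v).sqrt hs.ne') hr.ne'
  simp only [one_div] at h
  refine HasDirDeriv.congr_deriv (f := potential a b) h ?_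
  rw [potential, conformalForm, factor, LinearMap.smul_apply, smul_eq_mul]
  generalize √(1 - bsq a b x) = r at *
  rw [← hr2]
  field_simp
  ring

theorem deriv_conformalForm (S : SquareData μ U a b τ) {x : Vec n} (hx : x ∈ U) (y v : Vec n) :
    HasDirDeriv (fun x => conformalForm a b x y) x v
      (conn μ x y * conformalForm a b x v + conn μ x v * conformalForm a b x y +
        factor a b τ x * metric μ x y v) := by
  have hs := S.s_pos x hx
  have hr := Real.sqrt_pos.2 hs
  have hr2 := Real.sq_sqrt hs.le
  refine (((S.deriv_s hx v).sqrt hs.ne').mul (S.deriv_b hx y v)).congr_deriv ?_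
  rw [conformalForm, factor, LinearMap.smul_apply, LinearMap.smul_apply, smul_eq_mul, smul_eq_mul]
  generalize √(1 - bsq a b x) = r at *
  rw [← hr2]
  field_simp
  ring

theorem contDiffAt_conformalForm (S : SquareData μ U a b τ) {x : Vec n} (hx : x ∈ U)
    (y : Vec n) : ContDiffAt ℝ 2 (fun x => conformalForm a b x y) x := by
  have hU := S.isOpen.mem_nhds hx
  have h1 : ContDiffAt ℝ 2 (fun x => 1 - bsq a b x) x :=
    ((S.contDiff_s x hx).contDiffAt hU).of_le (by norm_cast)
  have h2 : ContDiffAt ℝ 2 (fun x => ∑ i, b x i * y i) x :=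
    ContDiffAt.sum fun i _ => (((S.contDiff_b i x hx).contDiffAt hU).of_le
      (by norm_cast)).mul contDiffAt_const
  simp only [conformalForm, LinearMap.smul_apply, smul_eq_mul, linForm_apply]
  exact (h1.sqrt (S.s_pos x hx).ne').mul h2

theorem differentiableAt_factor (S : SquareData μ U a b τ) {x : Vec n} (hx : x ∈ U) :
    DifferentiableAt ℝ (factor a b τ) x := by
  have hs := S.s_pos x hx
  have h1 := S.deriv_s hx 0
  have h2 : HasDirDeriv τ x 0 _ := ⟨S.contDiff_tau.differentiableAt_of_isOpen S.isOpen hx, rfl⟩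
  exact ((h2.mul (h1.sqrt hs.ne')).div (h1.pow 2) (by positivity)).1

theorem conformalForm_sq_lt (S : SquareData μ U a b τ) {x : Vec n} (hx : x ∈ U) {y : Vec n}
    (hy : y ≠ 0) :
    conformalForm a b x y ^ 2 < potential a b x ^ 2 * metric μ x y y := by
  have hs := S.s_pos x hx
  have hN := S.bsq_eq hx
  have hp := metric_pos (S.om_pos x hx) hy
  rw [S.potential_sq hx, conformalForm, LinearMap.smul_apply, smul_eq_mul, mul_pow,
    Real.sq_sqrt hs.le]
  set V := sharp μ x (b x)
  set s := 1 - bsq a b x with hsdef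
  have hb : bsq a b x = 1 - s := by rw [hsdef]; ring
  rw [hb] at hN
  have h1 : metric μ x V V = linForm (b x) V := metric_sharp (S.om_pos x hx) _ _
  have h2 : metric μ x V y = linForm (b x) y := metric_sharp (S.om_pos x hx) _ _
  have h3 : 0 ≤ metric μ x (metric μ x y y • V - linForm (b x) y • y)
      (metric μ x y y • V - linForm (b x) y • y) := by
    by_cases h0 : metric μ x y y • V - linForm (b x) y • y = 0
    · simp [h0]
    · exact (metric_pos (S.om_pos x hx) h0).le
  simp only [map_sub, map_smul, LinearMap.sub_apply, LinearMap.smul_apply, smul_eq_mul,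
    metric_symm μ x y V, h1, h2] at h3
  have h4 : linForm (b x) y ^ 2 ≤ metric μ x y y * linForm (b x) V :=
    le_of_mul_le_mul_left (by linarith) hp
  calc s * linForm (b x) y ^ 2 ≤ s * (metric μ x y y * linForm (b x) V) := by gcongr
    _ = s⁻¹ * ((s ^ 2 * linForm (b x) V) * metric μ x y y) := by field_simp
    _ < s⁻¹ * metric μ x y y := by
      rw [← hN]
      gcongr
      nlinarith

theorem conformalSystem [Nontrivial (Fin n)] (S : SquareData μ U a b τ) :
    ConformalSystem μ U (conn μ) (conformalForm a b) (metric μ) (factor a b τ)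
      (potential a b) where
  isOpen := S.isOpen
  symm _ _ := metric_symm μ _
  pos _ hx _ := metric_pos (S.om_pos _ hx)
  w_pos _ := S.potential_pos
  B_sq_lt _ hx _ := S.conformalForm_sq_lt hx
  deriv_Q x hx := deriv_conn (S.om_pos x hx)
  deriv_h x hx := deriv_metric (S.om_pos x hx)
  deriv_B _ hx := S.deriv_conformalForm hx
  deriv_c x hx := deriv_conformalFactor S.isOpen hx (metric_symm μ x)
    (fun _ => metric_pos (S.om_pos x hx)) (deriv_conn (S.om_pos x hx))
    (deriv_metric (S.om_pos x hx)) (fun _ => S.deriv_conformalForm)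
    (S.contDiffAt_conformalForm hx) (S.differentiableAt_factor hx)
  deriv_w _ hx := S.deriv_potential hx

end SquareData

theorem eq_of_hasDirDeriv_zero {n : ℕ} {U : Set (Vec n)} (hU : IsOpen U)
    (hconn : IsPreconnected U) {f : Vec n → ℝ} (hf : ∀ x ∈ U, ∀ v, HasDirDeriv f x v 0)
    {x y : Vec n} (hx : x ∈ U) (hy : y ∈ U) : f x = f y :=
  hU.is_const_of_fderiv_eq_zero hconn
    (fun z hz => (hf z hz 0).1.differentiableWithinAt)
    (fun z hz => ContinuousLinearMap.ext fun v => (hf z hz v).2) hx hy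

/-- The closed conformal 1-forms of a space form. -/
theorem ConformalSystem.exists_constants {n : ℕ} {μ : ℝ} {U : Set (Vec n)}
    {B : Vec n → Vec n →ₗ[ℝ] ℝ} {c w : Vec n → ℝ}
    (S : ConformalSystem μ U (conn μ) B (metric μ) c w) (hconn : IsConnected U)
    (hom : ∀ x ∈ U, 0 < om μ x) :
    ∃ (k : ℝ) (p : Vec n), ∀ x ∈ U,
      (∀ y, √(om μ x) * B x y = linForm p y + c x / √(om μ x) * linForm x y) ∧
        √(om μ x) * c x + μ * linForm p x = k := by
  have hz : ∀ x ∈ U, ∀ v, HasDirDeriv (fun x => √(om μ x)) x v (-√(om μ x) * conn μ x v) :=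
    fun x hx v => by
      have hr := Real.sqrt_pos.2 (hom x hx)
      refine ((deriv_om (hom x hx) v).sqrt (hom x hx).ne').congr_deriv ?_
      field_simp
      rw [Real.sq_sqrt (hom x hx).le]
      ring
  have h1 : ∀ y, ∀ x ∈ U, ∀ v, HasDirDeriv
      (fun x => √(om μ x) * B x y - c x / √(om μ x) * linForm x y) x v 0 := fun y x hx v => by
    have hr := Real.sqrt_pos.2 (hom x hx)
    refine (((hz x hx v).mul (S.deriv_B x hx y v)).sub
      (((S.deriv_c x hx v).div (hz x hx v) hr.ne').mul (deriv_linForm x y v))).congr_deriv ?_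
    have hr2 := Real.sq_sqrt (hom x hx).le
    rw [conn_apply, conn_apply, metric_apply, linForm_comm v y]
    generalize √(om μ x) = r at *
    rw [← hr2]
    field_simp
    ring
  obtain ⟨x₀, hx₀⟩ := hconn.nonempty
  let p : Vec n := fun i => √(om μ x₀) * B x₀ (Pi.single i 1) - c x₀ / √(om μ x₀) * x₀ i
  have h2 : ∀ x ∈ U, ∀ y,
      √(om μ x) * B x y = linForm p y + c x / √(om μ x) * linForm x y := fun x hx y => by
    have h3 : linForm p y = linForm (fun i =>
        √(om μ x) * B x (Pi.single i 1) - c x / √(om μ x) * x i) y := by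
      congr 2
      funext i
      simpa only [linForm_single] using
        eq_of_hasDirDeriv_zero S.isOpen hconn.isPreconnected (h1 (Pi.single i 1)) hx₀ hx
    rw [h3, linForm_apply, linForm_apply, ← linearMap_eq_sum (B x), Finset.mul_sum,
      Finset.mul_sum, ← Finset.sum_add_distrib]
    exact Finset.sum_congr rfl fun i _ => by ring
  refine ⟨√(om μ x₀) * c x₀ + μ * linForm p x₀, p, fun x hx => ⟨h2 x hx, ?_⟩⟩
  refine eq_of_hasDirDeriv_zero (f := fun x => √(om μ x) * c x + μ * linForm p x) S.isOpen
    hconn.isPreconnected (fun x hx v => ?_) hx hx₀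
  have hr := Real.sqrt_pos.2 (hom x hx)
  have hr2 := Real.sq_sqrt (hom x hx).le
  refine (((hz x hx v).mul (S.deriv_c x hx v)).add
    ((HasDirDeriv.linear (linForm p)).const_mul μ)).congr_deriv ?_
  have h3 := h2 x hx v
  rw [conn_apply]
  generalize √(om μ x) = r at *
  rw [← hr2]
  field_simp at h3 ⊢
  linear_combination (-μ) * h3

open ConformalSystem

theorem hmu_eq_rad {n : ℕ} {μ : ℝ} {x : Vec n} (hx : 0 < om μ x) (y : Vec n) :
    hmu μ x y = rad (metric μ) x y := by
  have h1 : metric μ x y y = (om μ x * linForm y y - μ * linForm x y ^ 2) / om μ x ^ 2 := by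
    rw [metric_apply]
    field_simp
  rw [rad, h1, Real.sqrt_div' _ (by positivity), Real.sqrt_sq hx.le]
  simp only [hmu, om, linForm_apply, sq]

theorem sigmaFun_eq {n : ℕ} (μ k : ℝ) (p x : Vec n) :
    sigmaFun μ k p x = √((k ^ 2 + (1 + linForm p p) * μ) * linForm x x +
      (2 * k - μ * linForm p x) * linForm p x + linForm p p + 1) := by
  simp only [sigmaFun, linForm_apply, sq]

namespace SquareData

variable {n : ℕ} {μ : ℝ} {U : Set (Vec n)} {a : Vec n → Matrix (Fin n) (Fin n) ℝ}
  {b : Vec n → Vec n} {τ : Vec n → ℝ}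

theorem alphaOf_eq (S : SquareData μ U a b τ) {x : Vec n} (hx : x ∈ U) (y : Vec n) :
    alphaOf a x y = potential a b x ^ 2 * rad (metric μ) x y := by
  rw [alphaOf, S.metric_eq_sq_mul hx, Real.sqrt_mul (by positivity),
    Real.sqrt_sq (by positivity), rad]

theorem betaOf_eq (S : SquareData μ U a b τ) {x : Vec n} (hx : x ∈ U) (y : Vec n) :
    betaOf b x y = potential a b x * conformalForm a b x y := by
  rw [S.potential_mul_conformalForm hx, linForm_apply, betaOf]

theorem alphaOf_add_betaOf [Nontrivial (Fin n)] (S : SquareData μ U a b τ) {x : Vec n}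
    (hx : x ∈ U) {y : Vec n} (hy : y ≠ 0) :
    alphaOf a x y + betaOf b x y = potential a b x * rad (metric μ) x y *
      (potential a b x + ratio (conformalForm a b) (metric μ) x y) := by
  have h := S.conformalSystem.rad_pos hx hy
  rw [S.alphaOf_eq hx, S.betaOf_eq hx, ratio]
  field_simp

theorem sqMetric_eq [Nontrivial (Fin n)] (S : SquareData μ U a b τ) {x : Vec n} (hx : x ∈ U)
    {y : Vec n} (hy : y ≠ 0) : sqMetric a b x y =
      squareMetric (conformalForm a b) (metric μ) (potential a b) x y := by
  have h := S.conformalSystem.rad_pos hx hy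
  have hw := S.potential_pos hx
  rw [sqMetric, S.alphaOf_add_betaOf hx hy, S.alphaOf_eq hx, squareMetric]
  field_simp

theorem potential_sq_eq_one_add (S : SquareData μ U a b τ) {x : Vec n} (hx : x ∈ U)
    {q : Vec n} (hq : ∀ y, √(om μ x) * conformalForm a b x y = linForm q y) :
    potential a b x ^ 2 = 1 + (linForm q q + μ * linForm x q ^ 2) := by
  have hom := S.om_pos x hx
  have hz := Real.sqrt_pos.2 hom
  have hz2 := Real.sq_sqrt hom.le
  have hs := S.s_pos x hx
  have hw := S.potential_pos hx
  have hw2 := S.potential_sq hx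
  have hN := S.bsq_eq hx
  have hb : b x = (potential a b x / √(om μ x)) • q := by
    funext i
    have h := hq (Pi.single i 1)
    rw [linForm_single] at h
    rw [Pi.smul_apply, smul_eq_mul, ← h, ← linForm_single (b x) i,
      ← S.potential_mul_conformalForm hx]
    field_simp
  rw [linForm_sharp, hb] at hN
  simp only [linForm_smul, map_smul, smul_eq_mul] at hN
  have h1 : (potential a b x / √(om μ x)) ^ 2 = ((1 - bsq a b x) * om μ x)⁻¹ := by
    rw [div_pow, hw2, hz2, mul_inv, div_eq_mul_inv]
  have h2 : bsq a b x =
      (1 - bsq a b x) * (linForm q q + μ * linForm x q ^ 2) := by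
    refine hN.trans ?_
    rw [show ∀ r P X : ℝ, r * (r * P) + μ * (r * X) ^ 2 = r ^ 2 * (P + μ * X ^ 2) from
      fun r P X => by ring, h1]
    field_simp
  rw [hw2]
  field_simp
  linear_combination h2

theorem exists_constants [Nontrivial (Fin n)] (S : SquareData μ U a b τ)
    (hconn : IsConnected U) : ∃ (k : ℝ) (p : Vec n), ∀ x ∈ U,
      sigmaFun μ k p x = potential a b x * √(om μ x) ∧
      (∀ y, √(om μ x) * conformalForm a b x y =
        linForm p y + (k - μ * linForm p x) / om μ x * linForm x y) ∧
      factor a b τ x ^ 2 + μ * potential a b x ^ 2 = k ^ 2 + μ + μ * linForm p p := by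
  obtain ⟨k, p, h⟩ := S.conformalSystem.exists_constants hconn S.om_pos
  refine ⟨k, p, fun x hx => ?_⟩
  obtain ⟨h1, h2⟩ := h x hx
  have hom := S.om_pos x hx
  have hz := Real.sqrt_pos.2 hom
  have hz2 := Real.sq_sqrt hom.le
  have hw := S.potential_pos hx
  have hX := om_eq μ x
  have h3 := S.potential_sq_eq_one_add hx (q := p + (factor a b τ x / √(om μ x)) • x)
    fun y => by rw [h1, linForm_add, linForm_smul]
  simp only [linForm_add, linForm_smul, map_add, map_smul, smul_eq_mul,
    linForm_comm x p] at h3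
  have hc : om μ x * (factor a b τ x / √(om μ x)) + μ * linForm p x = k := by
    rw [← h2, add_left_inj, ← mul_div_assoc, div_eq_iff hz.ne']
    linear_combination -factor a b τ x * hz2
  have hc2 : factor a b τ x ^ 2 = (factor a b τ x / √(om μ x)) ^ 2 * om μ x := by
    rw [div_pow, hz2]
    field_simp
  have hc3 : factor a b τ x / √(om μ x) = (k - μ * linForm p x) / om μ x := by
    rw [← hc]
    field_simp
    ring
  refine ⟨?_, fun y => by rw [h1, hc3], ?_⟩
  · rw [sigmaFun_eq, ← Real.sqrt_sq (mul_pos hw hz).le, mul_pow, hz2, h3, ← hc, hX]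
    congr 1
    ring
  · rw [h3, hc2, ← hc, hX]
    ring

end SquareData

theorem contDiffOn_of_conformal {n : ℕ} {μ : ℝ} {U : Set (Vec n)} (i : Fin n)
    (hom : ∀ x ∈ U, 0 < om μ x) {s f : Vec n → ℝ} (hf : ContDiffOn ℝ (⊤ : ℕ∞) f U)
    (hs : ∀ x ∈ U, 0 < s x) (h : ∀ x ∈ U, s x ^ 2 * f x = hMat μ x i i) :
    ContDiffOn ℝ (⊤ : ℕ∞) s U := by
  have hpos : ∀ x ∈ U, 0 < hMat μ x i i := fun x hx => by
    rw [← metric_single (hom x hx)]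
    exact metric_pos (hom x hx) (by simp)
  have hf0 : ∀ x ∈ U, f x ≠ 0 := fun x hx h0 => by
    have := hpos x hx
    rw [← h x hx, h0, mul_zero] at this
    exact this.false
  have h1 : ContDiff ℝ (⊤ : ℕ∞) (om (n := n) μ) := by
    unfold om
    fun_prop
  have h2 : ContDiff ℝ (⊤ : ℕ∞) fun x : Vec n => om μ x * 1 - μ * x i * x i := by fun_prop
  have h3 : ContDiffOn ℝ (⊤ : ℕ∞) (fun x => hMat μ x i i / f x) U := by
    have h4 := (h2.contDiffOn.div (s := U) (h1.pow 2).contDiffOn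
      fun x hx => (pow_pos (hom x hx) 2).ne').div hf hf0
    refine h4.congr fun x _ => ?_
    simp [hMat, om]
  refine (h3.sqrt fun x hx => div_ne_zero (hpos x hx).ne' (hf0 x hx)).congr fun x hx => ?_
  rw [← h x hx, mul_div_cancel_right₀ _ (hf0 x hx), Real.sqrt_sq (hs x hx).le]

/-- Theorem 4.1 (local structure): if a square metric of scalar flag curvature
(equivalently, (E1)–(E3) hold) has deformed metric `h = (1−b²)α` equal to the
standard constant-curvature metric `h_μ`, then `α` and `β` take the explicit form
(4.2)–(4.3), and the scalar flag curvature is given by (4.4). -/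
theorem stmt_9 {n : ℕ} (hn : 3 ≤ n) (μ : ℝ) (U : Set (Vec n))
    (hU : IsOpen U) (hconn : IsConnected U)
    (a : Vec n → Matrix (Fin n) (Fin n) ℝ) (b : Vec n → Vec n)
    (ha : ∀ i j, ContDiffOn ℝ (⊤ : ℕ∞) (fun x => a x i j) U)
    (hsym : ∀ x ∈ U, (a x).IsSymm)
    (hpos : ∀ x ∈ U, (a x).PosDef)
    (hb : ∀ i, ContDiffOn ℝ (⊤ : ℕ∞) (fun x => b x i) U)
    (hb2 : ∀ x ∈ U, 0 < bsq a b x ∧ bsq a b x < 1)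
    (τ lam : Vec n → ℝ)
    (hτ : ContDiffOn ℝ (⊤ : ℕ∞) τ U) (hlam : ContDiffOn ℝ (⊤ : ℕ∞) lam U)
    (hE : E123 U a b τ lam)
    (hUsub : U ⊆ {x : Vec n | 0 < 1 + μ * ∑ l, (x l)^2})
    (hdef : ∀ x ∈ U, ∀ i j : Fin n,
      (1 - bsq a b x)^2 * a x i j = hMat μ x i j) :
    ∃ (k : ℝ) (av : Vec n),
      (∀ x ∈ U, ∀ y : Vec n,
        alphaOf a x y =
          (sigmaFun μ k av x)^2 / (1 + μ * ∑ l, (x l)^2) * hmu μ x y) ∧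
      (∀ x ∈ U, ∀ y : Vec n,
        betaOf b x y =
          sigmaFun μ k av x / (1 + μ * ∑ l, (x l)^2) *
            ((∑ l, av l * y l)
              + (k - μ * ∑ l, av l * x l) / (1 + μ * ∑ l, (x l)^2)
                * (∑ l, x l * y l))) ∧
      (∀ x ∈ U, ∀ y : Vec n, y ≠ 0 → ∀ i j : Fin n,
        curvOfSpray (geoCoeff (sqMetric a b)) i j x y =
          ((k^2 + μ + μ * ∑ l, (av l)^2) * (1 + μ * ∑ l, (x l)^2)^3
              / (sigmaFun μ k av x)^6
            * (alphaOf a x y)^3 / (alphaOf a x y + betaOf b x y)^3) *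
          ((sqMetric a b x y)^2 * (if i = j then (1:ℝ) else 0)
            - y i * ∑ l, fundTensor (sqMetric a b) x y j l * y l)) := by
  have : Nontrivial (Fin n) := Fin.nontrivial_iff_two_le.2 (by omega)
  have hom : ∀ x ∈ U, 0 < om μ x := hUsub
  have S : SquareData μ U a b τ :=
    { isOpen := hU
      om_pos := hom
      contDiff_b := hb
      contDiff_tau := hτ
      contDiff_s := contDiffOn_of_conformal (Classical.arbitrary (Fin n)) hom (ha _ _)
        (fun x hx => sub_pos.2 (hb2 x hx).2) fun x hx => hdef x hx _ _
      s_pos := fun x hx => sub_pos.2 (hb2 x hx).2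
      conformal := hdef
      cov := hE.1 }
  obtain ⟨k, p, h⟩ := S.exists_constants hconn
  refine ⟨k, p, fun x hx y => ?_, fun x hx y => ?_, fun x hx y hy i j => ?_⟩ <;>
    obtain ⟨h1, h2, h3⟩ := h x hx <;>
    have hz := Real.sqrt_pos.2 (hom x hx) <;>
    have hz2 := Real.sq_sqrt (hom x hx).le <;>
    have hw := S.potential_pos hx
  · change _ = _ / om μ x * _
    rw [S.alphaOf_eq hx, hmu_eq_rad (hom x hx), h1, mul_pow, hz2]
    have := hom x hx
    field_simp
  · simp only [← linForm_apply]
    change _ = _ / om μ x * (_ + _ / om μ x * _)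
    rw [← h2, h1, S.betaOf_eq hx]
    nth_rewrite 2 [← hz2]
    field_simp
  · have hr := S.conformalSystem.rad_pos hx hy
    have hu := S.conformalSystem.add_ratio_pos hx hy
    rw [S.conformalSystem.curvOfSpray_geoCoeff (fun x hx y => S.sqMetric_eq hx) hx hy, h3,
      S.alphaOf_add_betaOf hx hy, S.alphaOf_eq hx, h1]
    congr 1
    change _ = _ * om μ x ^ 3 / _ * _ / _
    simp only [linForm_apply, ← sq]
    generalize √(om μ x) = z at *
    rw [← hz2]
    generalize SquareData.potential a b x +
      ratio (SquareData.conformalForm a b) (metric μ) x y = u at *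
    field_simp
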